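/- arXiv:2605.02692 — 3 statements merged into one kernel-verified Lean document; each statement's English description precedes it below -/
import Mathlib

section
/- Let d be an even positive integer with d ≥ 2. Then 𝕄_d^2 is dense in 𝕄_d with respect to the Frobenius norm: for every W ∈ 𝕄_d and every ε > 0 there exists W′ ∈ 𝕄_d^2 such that ‖W′ − W‖_F < ε. -/
open Matrix

/-- The Frobenius norm of a real square matrix. -/
noncomputable def frobNorm {d : ℕ} (M : Matrix (Fin d) (Fin d) ℝ) : ℝ :=
  Real.sqrt (∑ i, ∑ j, (M i j) ^ 2)

/-- `M` is block diagonal with consecutive `2 × 2` diagonal blocks, i.e. it is a matrix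
direct sum `W⁽¹⁾ ⊕ ⋯ ⊕ W⁽ᵈᐟ²⁾` of `2 × 2` real matrices. -/
def IsBlockDiag2x2 {d : ℕ} (M : Matrix (Fin d) (Fin d) ℝ) : Prop :=
  ∀ i j : Fin d, (i : ℕ) / 2 ≠ (j : ℕ) / 2 → M i j = 0

/-- Membership in `𝕄_d^2`: rank at least two, and similar over `ℝ` to a direct sum of
`2 × 2` real blocks. -/
def MemM2 {d : ℕ} (W : Matrix (Fin d) (Fin d) ℝ) : Prop :=
  2 ≤ W.rank ∧
    ∃ B : Matrix (Fin d) (Fin d) ℝ, IsUnit B.det ∧ IsBlockDiag2x2 (B⁻¹ * W * B)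

open Polynomial Module

/-- A real endomorphism without eigenvalues of a nonzero finite-dimensional space has an invariant
plane. -/
lemma exists_invtSubmodule_finrank_eq_two_of_forall_not_hasEigenvalue {V : Type*} [AddCommGroup V]
    [Module ℝ V] [FiniteDimensional ℝ V] [Nontrivial V] (T : End ℝ V)
    (hT : ∀ μ, ¬ T.HasEigenvalue μ) :
    ∃ U ∈ T.invtSubmodule, finrank ℝ U = 2 := by
  have hint : IsIntegral ℝ T := Algebra.IsIntegral.isIntegral T
  obtain ⟨p, hp, q, hq⟩ := WfDvdMonoid.exists_irreducible_factor (minpoly.not_isUnit ℝ T)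
    (minpoly.ne_zero hint)
  have hroot (μ : ℝ) : ¬ p.IsRoot μ := fun h ↦
    hT μ (End.hasEigenvalue_of_isRoot (h.dvd ⟨q, hq⟩))
  have hdeg : p.natDegree = 2 := by
    have h2 : p.natDegree ≤ 2 := natDegree_le_of_degree_le hp.degree_le_two
    have h0 : p.natDegree ≠ 0 := hp.natDegree_pos.ne'
    have h1 : p.natDegree ≠ 1 := fun h ↦ by
      obtain ⟨x, hx⟩ := exists_root_of_degree_eq_one (degree_eq_iff_natDegree_eq hp.ne_zero |>.2 h)
      exact hroot x hx
    omega
  obtain ⟨x, hx⟩ : ∃ x, aeval T q x ≠ 0 := by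
    by_contra! h
    have hq0 : q ≠ 0 := by
      rintro rfl
      exact minpoly.ne_zero hint (by simpa using hq)
    have hle := natDegree_le_of_dvd (minpoly.dvd ℝ T (LinearMap.ext h : aeval T q = 0)) hq0
    rw [hq, natDegree_mul hp.ne_zero hq0] at hle
    omega
  set v := aeval T q x with hv
  have hpv : aeval T p v = 0 := by
    rw [hv, ← Module.End.mul_apply, ← map_mul, ← hq, minpoly.aeval, LinearMap.zero_apply]
  have hlin : LinearIndependent ℝ ![v, T v] := by
    rw [LinearIndependent.pair_iff' hx]
    intro a ha
    exact hT a (End.hasEigenvalue_of_hasEigenvector (x := v)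
      ⟨End.mem_eigenspace_iff.2 ha.symm, hx⟩)
  refine ⟨Submodule.span ℝ (Set.range ![v, T v]), ?_, by simp [finrank_span_eq_card hlin]⟩
  rw [End.mem_invtSubmodule, Submodule.span_le]
  rintro _ ⟨i, rfl⟩
  simp only [SetLike.mem_coe, Submodule.mem_comap, Matrix.range_cons, Matrix.range_empty,
    Set.union_empty, Set.singleton_union, Submodule.mem_span_pair]
  fin_cases i
  · exact ⟨0, 1, by simp⟩
  · have hc : p.coeff 2 ≠ 0 := by
      rw [← hdeg]
      exact leadingCoeff_ne_zero.2 hp.ne_zero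
    rw [aeval_eq_sum_range, hdeg] at hpv
    simp only [Finset.sum_range_succ, Finset.sum_range_zero, zero_add, pow_zero, pow_one,
      LinearMap.add_apply, LinearMap.smul_apply, Module.End.one_apply, pow_two,
      Module.End.mul_apply] at hpv
    refine ⟨-(p.coeff 0 / p.coeff 2), -(p.coeff 1 / p.coeff 2), ?_⟩
    have h := congrArg ((p.coeff 2)⁻¹ • ·) hpv
    simp only [smul_add, smul_smul, inv_mul_cancel₀ hc, one_smul, smul_zero] at h
    simp only [Matrix.cons_val_zero, Matrix.cons_val_one, Fin.mk_one, neg_smul, div_eq_inv_mul]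
    rw [eq_comm, ← sub_eq_zero, ← h]
    abel

/-- A semisimple real endomorphism of a space of dimension at least two has an invariant plane. -/
lemma Module.End.IsSemisimple.exists_invtSubmodule_finrank_eq_two {V : Type*} [AddCommGroup V]
    [Module ℝ V] [FiniteDimensional ℝ V] {T : End ℝ V} (hT : T.IsSemisimple)
    (hV : 2 ≤ finrank ℝ V) :
    ∃ U ∈ T.invtSubmodule, finrank ℝ U = 2 := by
  by_cases h : ∀ μ, ¬ T.HasEigenvalue μ
  · have : Nontrivial V := nontrivial_of_finrank_pos (R := ℝ) (by omega)
    exact exists_invtSubmodule_finrank_eq_two_of_forall_not_hasEigenvalue T h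
  push Not at h
  obtain ⟨μ, hμ⟩ := h
  obtain ⟨v, hv, hv0⟩ := hμ.exists_hasEigenvector
  rw [mem_eigenspace_iff] at hv
  have hL : ℝ ∙ v ∈ T.invtSubmodule := by
    rw [mem_invtSubmodule, Submodule.span_singleton_le_iff_mem, Submodule.mem_comap, hv]
    exact Submodule.smul_mem _ _ (Submodule.mem_span_singleton_self v)
  obtain ⟨L', hL', hc⟩ := isSemisimple_iff.1 hT _ hL
  have hdim := Submodule.finrank_add_eq_of_isCompl hc
  rw [finrank_span_singleton hv0] at hdim
  have : Nontrivial L' := nontrivial_of_finrank_pos (R := ℝ) (by omega)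
  by_cases h' : ∀ ν, ¬ HasEigenvalue (T.restrict hL') ν
  · obtain ⟨U, hU, hU2⟩ :=
      exists_invtSubmodule_finrank_eq_two_of_forall_not_hasEigenvalue (T.restrict hL') h'
    refine ⟨U.map L'.subtype, ?_, ?_⟩
    · rw [mem_invtSubmodule]
      rintro _ ⟨x, hx, rfl⟩
      exact ⟨_, hU hx, rfl⟩
    · rw [← hU2]
      exact (Submodule.equivMapOfInjective _ L'.injective_subtype U).finrank_eq.symm
  · push Not at h'
    obtain ⟨ν, hν⟩ := h'
    obtain ⟨w, hw, hw0⟩ := hν.exists_hasEigenvector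
    rw [mem_eigenspace_iff] at hw
    replace hw : T w = ν • (w : V) := congrArg Subtype.val hw
    have hlin : LinearIndependent ℝ ![v, (w : V)] := by
      rw [LinearIndependent.pair_iff' hv0]
      intro a ha
      refine hw0 (Subtype.ext (Submodule.disjoint_def.1 hc.disjoint w ?_ w.2))
      exact Submodule.mem_span_singleton.2 ⟨a, ha⟩
    refine ⟨Submodule.span ℝ (Set.range ![v, (w : V)]), ?_, by simp [finrank_span_eq_card hlin]⟩
    rw [mem_invtSubmodule, Submodule.span_le]
    rintro _ ⟨i, rfl⟩
    simp only [SetLike.mem_coe, Submodule.mem_comap, Matrix.range_cons, Matrix.range_empty,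
      Set.union_empty, Set.singleton_union, Submodule.mem_span_pair]
    fin_cases i
    · exact ⟨μ, 0, by simp [hv]⟩
    · exact ⟨0, ν, by simp [hw]⟩

/-- A semisimple real endomorphism of a space of even dimension is block diagonal with `2 × 2`
blocks in a suitable basis. -/
lemma Module.End.IsSemisimple.exists_basis_repr_eq_zero (n : ℕ) {V : Type*} [AddCommGroup V]
    [Module ℝ V] [FiniteDimensional ℝ V] {T : End ℝ V} (hT : T.IsSemisimple)
    (hV : finrank ℝ V = n * 2) :
    ∃ b : Basis (Fin n × Fin 2) ℝ V, ∀ p q, p.1 ≠ q.1 → b.repr (T (b q)) p = 0 := by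
  induction n generalizing V with
  | zero =>
    have := finrank_zero_iff.1 (hV.trans (zero_mul 2))
    exact ⟨Basis.empty V, fun p ↦ p.1.elim0⟩
  | succ n ih =>
    obtain ⟨U, hU, hU2⟩ := hT.exists_invtSubmodule_finrank_eq_two (by omega)
    obtain ⟨U', hU', hc⟩ := isSemisimple_iff.1 hT U hU
    have hdim := Submodule.finrank_add_eq_of_isCompl hc
    obtain ⟨c, hcb⟩ := ih (hT.restrict hU') (by omega)
    let e : Fin (n + 1) × Fin 2 ≃ Fin 2 ⊕ Fin n × Fin 2 :=
      ((finSuccEquiv n).prodCongr (.refl _)).trans optionProdEquiv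
    let b₀ := ((finBasisOfFinrankEq ℝ U hU2).prod c).map (Submodule.prodEquivOfIsCompl U U' hc)
    refine ⟨b₀.reindex e.symm, ?_⟩
    have hl (j) : T (b₀ (.inl j)) = Submodule.prodEquivOfIsCompl U U' hc
        (T.restrict hU (finBasisOfFinrankEq ℝ U hU2 j), 0) := by
      simp [b₀]
      rfl
    have hr (j) : T (b₀ (.inr j)) = Submodule.prodEquivOfIsCompl U U' hc
        (0, T.restrict hU' (c j)) := by
      simp [b₀]
      rfl
    rintro ⟨i, j⟩ ⟨i', j'⟩ hne
    rw [Basis.repr_reindex_apply, Basis.reindex_apply, Equiv.symm_symm]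
    induction i using Fin.cases with
    | zero =>
      induction i' using Fin.cases with
      | zero => exact absurd rfl hne
      | succ i' =>
        have h₁ : e (0, j) = .inl j := rfl
        have h₂ : e (i'.succ, j') = .inr (i', j') := by simp [e, optionProdEquiv]
        rw [h₁, h₂, hr]
        simp [b₀]
    | succ i =>
      have h₁ : e (i.succ, j) = .inr (i, j) := by simp [e, optionProdEquiv]
      induction i' using Fin.cases with
      | zero =>
        have h₂ : e (0, j') = .inl j' := rfl
        rw [h₁, h₂, hl]
        simp [b₀]
      | succ i' =>
        have h₂ : e (i'.succ, j') = .inr (i', j') := by simp [e, optionProdEquiv]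
        rw [h₁, h₂, hr]
        simpa [b₀] using hcb (i, j) (i', j') (fun h ↦ hne (congrArg Fin.succ h))

/-- A real matrix of even size with separable characteristic polynomial is similar to a block
diagonal matrix with `2 × 2` blocks. -/
lemma exists_isBlockDiag2x2_of_separable_charpoly {d : ℕ} (hd : Even d)
    (W : Matrix (Fin d) (Fin d) ℝ) (hW : W.charpoly.Separable) :
    ∃ B : Matrix (Fin d) (Fin d) ℝ, IsUnit B.det ∧ IsBlockDiag2x2 (B⁻¹ * W * B) := by
  obtain ⟨n, rfl⟩ : ∃ n, d = n * 2 := by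
    obtain ⟨n, hn⟩ := hd
    exact ⟨n, by omega⟩
  have hss : End.IsSemisimple (Matrix.toLin' W) :=
    End.isSemisimple_of_squarefree_aeval_eq_zero hW.squarefree <| by
      rw [← Matrix.charpoly_toLin', LinearMap.aeval_self_charpoly]
  obtain ⟨b₀, hb₀⟩ := hss.exists_basis_repr_eq_zero n (by simp)
  let b := b₀.reindex finProdFinEquiv
  let s := Pi.basisFun ℝ (Fin (n * 2))
  have hmul : b.toMatrix s * s.toMatrix b = 1 := b.toMatrix_mul_toMatrix_flip s
  refine ⟨s.toMatrix b, ?_, fun i j hij ↦ ?_⟩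
  · exact Matrix.isUnit_det_of_left_inverse hmul
  · have hW' : LinearMap.toMatrix s s (Matrix.toLin' W) = W := by
      rw [LinearMap.toMatrix_eq_toMatrix', LinearMap.toMatrix'_toLin']
    rw [Matrix.inv_eq_left_inv hmul]
    nth_rw 1 [← hW']
    rw [basis_toMatrix_mul_linearMap_toMatrix_mul_basis_toMatrix, LinearMap.toMatrix_apply,
      Basis.repr_reindex_apply, Basis.reindex_apply]
    refine hb₀ _ _ fun h ↦ hij ?_
    simpa [Fin.ext_iff] using h

/-- The real matrices with nonzero determinant and separable characteristic polynomial are dense. -/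
lemma exists_separable_charpoly_frobNorm_sub_lt {d : ℕ} (W : Matrix (Fin d) (Fin d) ℝ) {ε : ℝ}
    (hε : 0 < ε) :
    ∃ W' : Matrix (Fin d) (Fin d) ℝ,
      W'.charpoly.Separable ∧ W'.det ≠ 0 ∧ frobNorm (W' - W) < ε := by
  let A : Matrix (Fin d) (Fin d) ℝ := diagonal fun i ↦ (i : ℝ) + 1
  let P : Matrix (Fin d) (Fin d) ℝ[X] := .of fun i j ↦ C (W i j) + X * C (A i j - W i j)
  let Wt (t : ℝ) : Matrix (Fin d) (Fin d) ℝ := P.map (evalRingHom t)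
  have hW1 : Wt 1 = A := by
    ext i j
    simp [Wt, P]
  have hcont : Continuous fun t ↦ frobNorm (Wt t - W) := by
    unfold frobNorm
    simp only [Wt, P, Matrix.sub_apply, Matrix.map_apply, Matrix.of_apply, coe_evalRingHom,
      eval_add, eval_mul, eval_C, eval_X]
    fun_prop
  have h0 : frobNorm (Wt 0 - W) = 0 := by simp [frobNorm, Wt, P]
  let R : ℝ[X] := resultant P.charpoly (derivative P.charpoly) d (d - 1)
  have hR (t : ℝ) : R.eval t ≠ 0 ↔ (Wt t).charpoly.Separable := by
    have h : R.eval t = resultant (Wt t).charpoly (derivative (Wt t).charpoly) := by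
      rw [natDegree_derivative, Matrix.charpoly_natDegree_eq_dim, Fintype.card_fin,
        Matrix.charpoly_map, derivative_map, resultant_map_map, coe_evalRingHom]
    rw [h, ← isUnit_iff_ne_zero, isUnit_resultant_iff_isCoprime (Matrix.charpoly_monic _),
      Separable]
  have hdet (t : ℝ) : P.det.eval t = (Wt t).det := by
    simpa [Wt] using RingHom.map_det (evalRingHom t) P
  have hne : R * P.det ≠ 0 := by
    intro h
    have h1 : R.eval 1 * P.det.eval 1 = 0 := by rw [← eval_mul, h, eval_zero]
    refine mul_ne_zero ((hR 1).2 ?_) ?_ h1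
    · rw [hW1, Matrix.charpoly_diagonal, separable_prod_X_sub_C_iff]
      intro i j hij
      exact Fin.ext (by simpa using hij)
    · rw [hdet, hW1, Matrix.det_diagonal, Finset.prod_ne_zero_iff]
      intro i _
      positivity
  have hinf : {t : ℝ | frobNorm (Wt t - W) < ε}.Infinite :=
    infinite_of_mem_nhds 0 (hcont.continuousAt.eventually_lt continuousAt_const (by rwa [h0]))
  obtain ⟨t, ht, hroot⟩ := (hinf.sdiff (R * P.det).roots.toFinset.finite_toSet).nonempty
  rw [Finset.mem_coe, Multiset.mem_toFinset, mem_roots hne, IsRoot, eval_mul, mul_eq_zero,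
    not_or, hdet] at hroot
  exact ⟨Wt t, (hR t).1 hroot.1, hroot.2, ht⟩

/-- For even `d ≥ 2`, the set `𝕄_d^2` is dense in `𝕄_d` (all `d × d` real matrices of rank
at least two) with respect to the Frobenius norm. -/
theorem stmt0 (d : ℕ) (hEven : Even d) (hd : 2 ≤ d)
    (W : Matrix (Fin d) (Fin d) ℝ) (hW : 2 ≤ W.rank)
    (ε : ℝ) (hε : 0 < ε) :
    ∃ W' : Matrix (Fin d) (Fin d) ℝ, MemM2 W' ∧ frobNorm (W' - W) < ε := by
  obtain ⟨W', hsep, hdet, hlt⟩ := exists_separable_charpoly_frobNorm_sub_lt W hε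
  refine ⟨W', ⟨?_, exists_isBlockDiag2x2_of_separable_charpoly hEven W' hsep⟩, hlt⟩
  rwa [Matrix.rank_of_isUnit W' ((Matrix.isUnit_iff_isUnit_det W').2 hdet.isUnit),
    Fintype.card_fin]
end

section
/- Let d be an even positive integer with d ≥ 2. Then 𝕄_d^1 is not dense in 𝕄_d with respect to the Frobenius norm: there exist a matrix W ∈ 𝕄_d and a real number ε > 0 such that every W̃ ∈ 𝕄_d^1 satisfies ‖W̃ − W‖_F > ε. -/
open Matrix

/-- Membership in `𝕄_d^1`: rank at least two, and similar over `ℝ` to a diagonal matrix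
with real entries (i.e. diagonalizable over `ℝ`). -/
def MemM1 {d : ℕ} (W : Matrix (Fin d) (Fin d) ℝ) : Prop :=
  2 ≤ W.rank ∧
    ∃ B : Matrix (Fin d) (Fin d) ℝ, IsUnit B.det ∧ (B⁻¹ * W * B).IsDiag

/-- The square of a real matrix that is diagonalizable over `ℝ` has nonnegative trace. -/
theorem MemM1.trace_mul_self_nonneg {d : ℕ} {W : Matrix (Fin d) (Fin d) ℝ} (hW : MemM1 W) :
    0 ≤ (W * W).trace := by
  obtain ⟨-, B, hB, hD⟩ := hW
  have key : (W * W).trace = ((B⁻¹ * W * B) * (B⁻¹ * W * B)).trace := by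
    have : (B⁻¹ * W * B) * (B⁻¹ * W * B) = B⁻¹ * (W * W) * B := by
      simp only [Matrix.mul_assoc, Matrix.mul_nonsing_inv_cancel_left _ _ hB]
    rw [this, Matrix.trace_mul_cycle, Matrix.mul_nonsing_inv _ hB, Matrix.one_mul]
  rw [key, ← hD.diagonal_diag, Matrix.diagonal_mul_diagonal, Matrix.trace_diagonal]
  exact Finset.sum_nonneg fun i _ => mul_self_nonneg _

theorem sum_sq_eq_frobNorm_sq {d : ℕ} (M : Matrix (Fin d) (Fin d) ℝ) :
    ∑ i, ∑ j, (M i j) ^ 2 = frobNorm M ^ 2 :=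
  (Real.sq_sqrt (by positivity)).symm

theorem abs_apply_le_frobNorm {d : ℕ} (M : Matrix (Fin d) (Fin d) ℝ) (i j : Fin d) :
    |M i j| ≤ frobNorm M := by
  refine Real.abs_le_sqrt ?_
  refine le_trans ?_ (Finset.single_le_sum (f := fun i => ∑ j, (M i j) ^ 2)
    (fun _ _ => by positivity) (Finset.mem_univ i))
  exact Finset.single_le_sum (f := fun j => (M i j) ^ 2)
    (fun _ _ => by positivity) (Finset.mem_univ j)

theorem trace_mul_self_le_frobNorm_sq {d : ℕ} (M : Matrix (Fin d) (Fin d) ℝ) :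
    (M * M).trace ≤ frobNorm M ^ 2 := by
  have h : (M * M).trace ≤ ∑ i, ∑ j, ((M i j) ^ 2 + (M j i) ^ 2) / 2 := by
    simp only [Matrix.trace, Matrix.diag_apply, Matrix.mul_apply]
    gcongr with i _ j _
    nlinarith [sq_nonneg (M i j - M j i)]
  have h2 : ∑ i, ∑ j, (M j i) ^ 2 = frobNorm M ^ 2 := by
    rw [Finset.sum_comm, sum_sq_eq_frobNorm_sq]
  simp only [← Finset.sum_div, Finset.sum_add_distrib, h2, sum_sq_eq_frobNorm_sq] at h
  linarith

/-- The infinitesimal rotation in the plane spanned by two distinct basis vectors has rank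
at least two. -/
theorem two_le_rank_single_sub_single {d : ℕ} {a b : Fin d} (hab : a ≠ b) :
    2 ≤ (single a b (1 : ℝ) - single b a 1).rank := by
  have h : (single a b (1 : ℝ) - single b a 1).submatrix ![a, b] ![a, b] = !![0, 1; -1, 0] := by
    ext i j
    fin_cases i <;> fin_cases j <;> simp [hab, hab.symm]
  have hr : (!![0, 1; -1, 0] : Matrix (Fin 2) (Fin 2) ℝ).rank = 2 := by
    rw [Matrix.rank_of_isUnit]
    · simp
    · simp [Matrix.isUnit_iff_isUnit_det, Matrix.det_fin_two]
  rw [← hr, ← h]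
  exact Matrix.rank_submatrix_le _ _ _

/-- For even `d ≥ 2`, the set `𝕄_d^1` is not dense in `𝕄_d` (all `d × d` real matrices of
rank at least two) with respect to the Frobenius norm: there are `W ∈ 𝕄_d` and `ε > 0` such
that every `W̃ ∈ 𝕄_d^1` satisfies `‖W̃ − W‖_F > ε`. -/
theorem stmt1 (d : ℕ) (hEven : Even d) (hd : 2 ≤ d) :
    ∃ (W : Matrix (Fin d) (Fin d) ℝ) (ε : ℝ), 2 ≤ W.rank ∧ 0 < ε ∧
      ∀ W' : Matrix (Fin d) (Fin d) ℝ, MemM1 W' → ε < frobNorm (W' - W) := by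
  obtain ⟨a, b, hab⟩ : ∃ a b : Fin d, a ≠ b :=
    ⟨⟨0, by lia⟩, ⟨1, by lia⟩, by simp⟩
  refine ⟨single a b 1 - single b a 1, 1 / 10, two_le_rank_single_sub_single hab,
    by norm_num, fun W' hW' => ?_⟩
  by_contra! hle
  set W : Matrix (Fin d) (Fin d) ℝ := single a b 1 - single b a 1 with hW
  obtain ⟨N, rfl⟩ : ∃ N, W' = W + N := ⟨W' - W, by simp⟩
  rw [add_sub_cancel_left] at hle
  have hexp : ((W + N) * (W + N)).trace = -2 + 2 * (N b a - N a b) + (N * N).trace := by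
    have hWW : (W * W).trace = -2 := by
      simp [hW, Matrix.sub_mul, Matrix.mul_sub, hab, hab.symm]
      norm_num
    have hWN : (W * N).trace = N b a - N a b := by
      simp [hW, Matrix.sub_mul, Matrix.trace_single_mul]
    rw [Matrix.add_mul, Matrix.mul_add, Matrix.mul_add, Matrix.trace_add, Matrix.trace_add,
      Matrix.trace_add, Matrix.trace_mul_comm N W, hWW, hWN]
    ring
  have h0 := hW'.trace_mul_self_nonneg
  have h1 := trace_mul_self_le_frobNorm_sq N
  have h2 := abs_le.1 (abs_apply_le_frobNorm N b a)
  have h3 := abs_le.1 (abs_apply_le_frobNorm N a b)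
  have h4 : 0 ≤ frobNorm N := Real.sqrt_nonneg _
  nlinarith
end

section
/- Let W be a random d×d real matrix whose entries are independent standard normal random variables (d ≥ 2). Then the probability that all d eigenvalues of W are real and pairwise distinct is at most 1 / 2^{d(d−1)/4}. (Equivalently, the probability that an RNN with recurrent matrix W provides only Type R-1 recurrence features is at most 1 / 2^{d(d−1)/4}.) -/
open Matrix Polynomial MeasureTheory ProbabilityTheory

theorem lintegral_ofReal_fintype_prod {ι : Type*} [Fintype ι] {E : ι → Type*}
    [∀ i, MeasureSpace (E i)] [∀ i, SigmaFinite (volume : Measure (E i))]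
    (f : ∀ i, E i → ℝ) (hf : ∀ i, Integrable (f i)) (hf0 : ∀ i x, 0 ≤ f i x) :
    ∫⁻ x : (∀ i, E i), ENNReal.ofReal (∏ i, f i (x i)) = ∏ i, ∫⁻ x, ENNReal.ofReal (f i x) := by
  rw [volume_pi, ← ofReal_integral_eq_lintegral_ofReal (Integrable.fintype_prod_dep hf)
    (.of_forall fun x => Finset.prod_nonneg fun i _ => hf0 i _),
    integral_fintype_prod_eq_prod,
    ENNReal.ofReal_prod_of_nonneg fun i _ => integral_nonneg (hf0 i)]
  exact Finset.prod_congr rfl fun i _ =>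
    ofReal_integral_eq_lintegral_ofReal (hf i) (.of_forall (hf0 i))

theorem setLIntegral_le_of_subset_image {E : Type*} [NormedAddCommGroup E] [NormedSpace ℝ E]
    [FiniteDimensional ℝ E] [MeasurableSpace E] [BorelSpace E] (μ : Measure E) [μ.IsAddHaarMeasure]
    {f : E → E} {f' : E → E →L[ℝ] E} (hf' : ∀ x, HasFDerivAt f (f' x) x)
    {A s : Set E} (hs : MeasurableSet s) (hAs : A ⊆ f '' s)
    {g : E → ENNReal} (hg : Measurable g) :
    ∫⁻ x in A, g x ∂μ ≤ ∫⁻ x in s, ENNReal.ofReal |(f' x).det| * g (f x) ∂μ := by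
  have hf : Measurable f :=
    (continuous_iff_continuousAt.2 fun x => (hf' x).continuousAt).measurable
  have hρ : AEMeasurable (fun x => ENNReal.ofReal |(f' x).det|) (μ.restrict s) :=
    aemeasurable_ofReal_abs_det_fderivWithin μ hs fun x _ => (hf' x).hasFDerivWithinAt
  have key : μ.restrict A ≤
      ((μ.restrict s).withDensity fun x => ENNReal.ofReal |(f' x).det|).map f := by
    refine Measure.le_iff.2 fun B hB => ?_
    have hsB : MeasurableSet (f ⁻¹' B ∩ s) := (hf hB).inter hs
    rw [Measure.restrict_apply hB, Measure.map_apply hf hB, withDensity_apply _ (hf hB),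
      Measure.restrict_restrict (hf hB)]
    refine (measure_mono ?_).trans
      (addHaar_image_le_lintegral_abs_det_fderiv μ hsB fun x _ => (hf' x).hasFDerivWithinAt)
    rintro _ ⟨hxB, hxA⟩
    obtain ⟨y, hy, rfl⟩ := hAs hxA
    exact ⟨y, ⟨hxB, hy⟩, rfl⟩
  calc ∫⁻ x in A, g x ∂μ
      ≤ ∫⁻ x, g x ∂(((μ.restrict s).withDensity fun x => ENNReal.ofReal |(f' x).det|).map f) :=
        lintegral_mono' key le_rfl
    _ = _ := by
      rw [lintegral_map hg hf]
      exact lintegral_withDensity_eq_lintegral_mul₀ hρ (hg.comp hf).aemeasurable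

theorem measurePreserving_of_preimage_eq {E F : Type*} [NormedAddCommGroup E] [NormedSpace ℝ E]
    [NormedAddCommGroup F] [NormedSpace ℝ F] [FiniteDimensional ℝ E] [FiniteDimensional ℝ F]
    [MeasurableSpace E] [BorelSpace E] [MeasurableSpace F] [BorelSpace F]
    (μ : Measure E) [μ.IsAddHaarMeasure] (ν : Measure F) [ν.IsAddHaarMeasure]
    (e : E ≃ₗ[ℝ] F) {K : Set F} (hK : MeasurableSet K) (hK0 : ν K ≠ 0) (hK1 : ν K ≠ ⊤)
    (h : μ (e ⁻¹' K) = ν K) : MeasurePreserving e μ ν := by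
  let e' := e.toContinuousLinearEquiv
  have hm : Measurable e := e'.continuous.measurable
  refine ⟨hm, ?_⟩
  have : (μ.map e).IsAddHaarMeasure := e'.isAddHaarMeasure_map μ
  have h1 := Measure.isAddLeftInvariant_eq_smul (μ.map e) ν
  have h2 : (μ.map e) K = ν K := by rw [Measure.map_apply hm hK, h]
  rw [h1, Measure.smul_apply] at h2
  rw [h1]
  have h3 : (Measure.addHaarScalarFactor (μ.map e) ν : ENNReal) * ν K = 1 * ν K := by
    rw [one_mul]; exact h2
  have h4 := (ENNReal.mul_left_inj hK0 hK1).1 h3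
  have h5 : Measure.addHaarScalarFactor (μ.map e) ν = 1 := by exact_mod_cast h4
  rw [h5, one_smul]

section Householder
variable {ι : Type*} [Fintype ι] [DecidableEq ι]

/-- The Householder reflection whose axis is the line through `(1, t)`. -/
noncomputable def householder (t : ι → ℝ) : Matrix (Unit ⊕ ι) (Unit ⊕ ι) ℝ :=
  1 - (2 / (1 + t ⬝ᵥ t)) • vecMulVec (Sum.elim 1 t) (Sum.elim 1 t)

omit [DecidableEq ι] in
theorem one_add_dotProduct_self_pos (t : ι → ℝ) : 0 < 1 + t ⬝ᵥ t := by
  have : 0 ≤ t ⬝ᵥ t := Finset.sum_nonneg fun i _ => mul_self_nonneg _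
  linarith

theorem transpose_householder (t : ι → ℝ) : (householder t)ᵀ = householder t := by
  simp [householder, transpose_vecMulVec]

theorem householder_mul_self (t : ι → ℝ) : householder t * householder t = 1 := by
  have h : (Sum.elim 1 t : Unit ⊕ ι → ℝ) ⬝ᵥ Sum.elim 1 t = 1 + t ⬝ᵥ t := by
    simp [dotProduct]
  have := (one_add_dotProduct_self_pos t).ne'
  simp only [householder, sub_mul, mul_sub, one_mul, mul_one, smul_mul_assoc, mul_smul_comm,
    vecMulVec_mul_vecMulVec, h, vecMulVec_smul, smul_smul]
  match_scalars
  · simp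
  · field_simp
    ring

theorem householder_inl_inl (t : ι → ℝ) :
    householder t (.inl ()) (.inl ()) = 1 - 2 / (1 + t ⬝ᵥ t) := by
  simp [householder, vecMulVec_apply]

theorem householder_inr_inl (t : ι → ℝ) (i : ι) :
    householder t (.inr i) (.inl ()) = -(2 / (1 + t ⬝ᵥ t) * t i) := by
  simp [householder, vecMulVec_apply]

attribute [local instance] Matrix.linftyOpNormedRing Matrix.linftyOpNormedAlgebra

theorem exists_hasFDerivAt_householder (t : ι → ℝ) :
    ∃ D : (ι → ℝ) →L[ℝ] Matrix (Unit ⊕ ι) (Unit ⊕ ι) ℝ,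
      HasFDerivAt householder D t ∧ ∀ u, (D u)ᵀ = D u ∧ householder t * D u =
        (2 / (1 + t ⬝ᵥ t)) •
        (vecMulVec (Sum.elim 1 t) (Sum.elim 0 u) - vecMulVec (Sum.elim 0 u) (Sum.elim 1 t)) := by
  have hpos := (one_add_dotProduct_self_pos t).ne'
  have hs : HasFDerivAt (fun t : ι → ℝ => 1 + t ⬝ᵥ t)
      (∑ k, (2 * t k) • ContinuousLinearMap.proj (R := ℝ) (φ := fun _ : ι => ℝ) k) t := by
    have : ∀ k ∈ Finset.univ, HasFDerivAt (fun t : ι → ℝ => t k * t k)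
        ((2 * t k) • ContinuousLinearMap.proj (R := ℝ) (φ := fun _ : ι => ℝ) k) t := fun k _ => by
      have h := (hasFDerivAt_apply (𝕜 := ℝ) k t)
      refine (h.mul h).congr_fderiv ?_
      ext u
      simp
      ring
    exact (HasFDerivAt.fun_sum this).const_add 1
  have hw : ∀ i : Unit ⊕ ι, HasFDerivAt (fun t : ι → ℝ => (Sum.elim 1 t : Unit ⊕ ι → ℝ) i)
      (Sum.elim (fun _ => 0) (fun k => ContinuousLinearMap.proj (R := ℝ) (φ := fun _ : ι => ℝ) k) i)
      t := by
    rintro (i | i)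
    · exact hasFDerivAt_const (1 : ℝ) t
    · exact hasFDerivAt_apply i t
  have hw' : ∀ (i : Unit ⊕ ι) (u : ι → ℝ), (Sum.elim (fun _ => 0)
      (fun k => ContinuousLinearMap.proj (R := ℝ) (φ := fun _ : ι => ℝ) k) i : (ι → ℝ) →L[ℝ] ℝ) u
      = (Sum.elim 0 u : Unit ⊕ ι → ℝ) i := by
    rintro (i | i) u <;> simp
  have hH : ∀ i j, ∃ L : (ι → ℝ) →L[ℝ] ℝ, HasFDerivAt (fun t => householder t i j) L t ∧
      ∀ u, L u = ((4 * (t ⬝ᵥ u) / (1 + t ⬝ᵥ t) ^ 2) •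
        vecMulVec (Sum.elim 1 t) (Sum.elim 1 t) - (2 / (1 + t ⬝ᵥ t)) •
        (vecMulVec (Sum.elim 1 t) (Sum.elim 0 u) + vecMulVec (Sum.elim 0 u) (Sum.elim 1 t)) :
          Matrix (Unit ⊕ ι) (Unit ⊕ ι) ℝ) i j := by
    intro i j
    refine ⟨_, ((((hasDerivAt_inv hpos).comp_hasFDerivAt t hs).const_mul 2).mul
      ((hw i).mul (hw j))).const_sub ((1 : Matrix (Unit ⊕ ι) (Unit ⊕ ι) ℝ) i j), fun u => ?_⟩
    have hsum : ∑ k, 2 * t k * u k = 2 * (t ⬝ᵥ u) := by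
      simp [dotProduct, Finset.mul_sum, mul_assoc]
    simp only [_root_.neg_apply, _root_.add_apply, _root_.smul_apply, hw', _root_.sum_apply,
      ContinuousLinearMap.proj_apply, smul_eq_mul, Function.comp, Pi.mul_apply, hsum,
      Matrix.sub_apply, Matrix.smul_apply, Matrix.add_apply, vecMulVec_apply]
    ring
  choose L hL hLu using hH
  obtain ⟨D, hD', hDu⟩ : ∃ D : (ι → ℝ) →L[ℝ] Matrix (Unit ⊕ ι) (Unit ⊕ ι) ℝ,
      HasFDerivAt householder D t ∧ ∀ u, D u = (4 * (t ⬝ᵥ u) / (1 + t ⬝ᵥ t) ^ 2) •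
        vecMulVec (Sum.elim 1 t) (Sum.elim 1 t) - (2 / (1 + t ⬝ᵥ t)) •
        (vecMulVec (Sum.elim 1 t) (Sum.elim 0 u) + vecMulVec (Sum.elim 0 u) (Sum.elim 1 t)) := by
    exact ⟨_, hasFDerivAt_pi.2 fun i => hasFDerivAt_pi.2 fun j => hL i j,
      fun u => Matrix.ext fun i j => hLu i j u⟩
  refine ⟨D, hD', fun u => ⟨?_, ?_⟩⟩
  · simp [hDu, transpose_vecMulVec, add_comm]
  have h1 : (Sum.elim 1 t : Unit ⊕ ι → ℝ) ⬝ᵥ Sum.elim 1 t = 1 + t ⬝ᵥ t := by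
    simp [dotProduct]
  have h2 : (Sum.elim 1 t : Unit ⊕ ι → ℝ) ⬝ᵥ Sum.elim 0 u = t ⬝ᵥ u := by
    simp [dotProduct]
  rw [hDu]
  simp only [householder, sub_mul, mul_sub, mul_add, one_mul, mul_one, smul_mul_assoc, mul_smul_comm,
    vecMulVec_mul_vecMulVec, h1, h2, vecMulVec_smul, smul_smul, smul_add]
  match_scalars <;> field_simp <;> ring

/-- The differential of a linear image of `householder t * N y * householder t`. -/
theorem exists_hasFDerivAt_conj_householder {F : Type*} [NormedAddCommGroup F] [NormedSpace ℝ F]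
    [FiniteDimensional ℝ F] {X : Type*} [NormedAddCommGroup X] [NormedSpace ℝ X]
    (N : F →ₗ[ℝ] Matrix (Unit ⊕ ι) (Unit ⊕ ι) ℝ) (p : Matrix (Unit ⊕ ι) (Unit ⊕ ι) ℝ →ₗ[ℝ] X)
    (x : (ι → ℝ) × F) :
    ∃ D : (ι → ℝ) × F →L[ℝ] X,
      HasFDerivAt (fun x : (ι → ℝ) × F => p (householder x.1 * N x.2 * householder x.1)) D x ∧
      ∀ u, D u = p (householder x.1 * (N u.2 + (2 / (1 + x.1 ⬝ᵥ x.1)) •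
        ((vecMulVec (Sum.elim 1 x.1) (Sum.elim 0 u.1) - vecMulVec (Sum.elim 0 u.1) (Sum.elim 1 x.1))
          * N x.2 - N x.2 *
        (vecMulVec (Sum.elim 1 x.1) (Sum.elim 0 u.1) - vecMulVec (Sum.elim 0 u.1) (Sum.elim 1 x.1))))
        * householder x.1) := by
  obtain ⟨D, hD, hDu⟩ := exists_hasFDerivAt_householder x.1
  have h1 := (hD.comp x hasFDerivAt_fst)
  have h2 := ((LinearMap.toContinuousLinearMap N).hasFDerivAt (x := x.2)).comp x hasFDerivAt_snd
  have h3 := (h1.mul' h2).mul' h1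
  have h4 := ((LinearMap.toContinuousLinearMap p).hasFDerivAt
    (x := householder x.1 * N x.2 * householder x.1)).comp x h3
  refine ⟨_, h4, fun u => ?_⟩
  have hDu' : D u.1 * householder x.1 = -(householder x.1 * D u.1) := by
    have := congrArg transpose (hDu u.1).2
    rw [transpose_mul, (hDu u.1).1, transpose_householder] at this
    rw [this, (hDu u.1).2]
    rw [← smul_neg, neg_sub]
    simp [transpose_vecMulVec]
  have hDu2 : D u.1 = householder x.1 * (householder x.1 * D u.1) := by
    rw [← mul_assoc, householder_mul_self, one_mul]
  have hDu3 : D u.1 = -(householder x.1 * D u.1 * householder x.1) := by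
    rw [mul_assoc, hDu', mul_neg, neg_neg, ← hDu2]
  change p (householder x.1 * N x.2 * D u.1 +
    (householder x.1 * N u.2 + D u.1 * N x.2) * householder x.1) = _
  rw [smul_sub, ← smul_mul_assoc, ← mul_smul_comm, ← (hDu u.1).2]
  congr 1
  have e1 : householder x.1 * N x.2 * D u.1 =
      -(householder x.1 * (N x.2 * (householder x.1 * D u.1)) * householder x.1) := by
    conv_lhs => rw [hDu3]
    noncomm_ring
  have e2 : D u.1 * N x.2 * householder x.1 =
      householder x.1 * (householder x.1 * D u.1 * N x.2) * householder x.1 := by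
    conv_lhs => rw [hDu2]
    noncomm_ring
  rw [add_mul, e1, e2]
  noncomm_ring
end Householder

theorem LinearMap.det_eq_det_of_fst_eq {A F : Type*} [AddCommGroup A] [Module ℝ A]
    [FiniteDimensional ℝ A] [AddCommGroup F] [Module ℝ F] [FiniteDimensional ℝ F]
    (P : A × F →ₗ[ℝ] A × F) (P₁ : A →ₗ[ℝ] A) (h₁ : ∀ u, (P u).1 = P₁ u.1)
    (h₂ : ∀ y, (P (0, y)).2 = y) : P.det = P₁.det := by
  let bA := Module.finBasis ℝ A
  let bF := Module.finBasis ℝ F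
  rw [← LinearMap.det_toMatrix (bA.prod bF), ← LinearMap.det_toMatrix bA]
  have : LinearMap.toMatrix (bA.prod bF) (bA.prod bF) P =
      Matrix.fromBlocks (LinearMap.toMatrix bA bA P₁) 0
        (LinearMap.toMatrix (bA.prod bF) (bA.prod bF) P).toBlocks₂₁ 1 := by
    ext (i | i) (j | j) <;>
      simp [LinearMap.toMatrix_apply, h₁, h₂, Matrix.one_apply, Finsupp.single_apply, eq_comm,
        toBlocks₂₁]
  rw [this, Matrix.det_fromBlocks_zero₁₂, Matrix.det_one, mul_one]

/-- A linear parametrization `(c, y) ↦ toMat (c, y)` of a space of matrices stable under conjugation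
by orthogonal matrices, whose parameter `c` is the first column below the diagonal. -/
structure MatrixChart (ι F : Type*) [Fintype ι] [DecidableEq ι] [AddCommGroup F]
    [Module ℝ F] where
  toMat : (ι → ℝ) × F →ₗ[ℝ] Matrix (Unit ⊕ ι) (Unit ⊕ ι) ℝ
  coord : Matrix (Unit ⊕ ι) (Unit ⊕ ι) ℝ →ₗ[ℝ] (ι → ℝ) × F
  coord_toMat : ∀ x, coord (toMat x) = x
  toMat_inr_inl : ∀ x i, toMat x (.inr i) (.inl ()) = x.1 i
  toMat_coord_commutator : ∀ x (A : Matrix (Unit ⊕ ι) (Unit ⊕ ι) ℝ), Aᵀ = -A →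
    toMat (coord (A * toMat x - toMat x * A)) = A * toMat x - toMat x * A
  toMat_coord_conj : ∀ x (H : Matrix (Unit ⊕ ι) (Unit ⊕ ι) ℝ), Hᵀ = H → H * H = 1 →
    toMat (coord (H * toMat x * H)) = H * toMat x * H

namespace MatrixChart

variable {ι F : Type*} [Fintype ι] [DecidableEq ι] [NormedAddCommGroup F] [NormedSpace ℝ F]
  [FiniteDimensional ℝ F] (c : MatrixChart ι F)

/-- The matrix with parameter `y` and vanishing first column below the diagonal. -/
def deflated : F →ₗ[ℝ] Matrix (Unit ⊕ ι) (Unit ⊕ ι) ℝ := c.toMat ∘ₗ LinearMap.inr ℝ (ι → ℝ) F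

/-- The coordinates of the matrix `householder t * deflated y * householder t`. -/
noncomputable def polar (x : (ι → ℝ) × F) : (ι → ℝ) × F :=
  c.coord (householder x.1 * c.deflated x.2 * householder x.1)

omit [FiniteDimensional ℝ F] in
theorem toMat_polar (x : (ι → ℝ) × F) :
    c.toMat (c.polar x) = householder x.1 * c.deflated x.2 * householder x.1 :=
  c.toMat_coord_conj _ _ (transpose_householder _) (householder_mul_self _)

/-- The absolute Jacobian determinant of `polar`. -/
noncomputable def jac (x : (ι → ℝ) × F) : ℝ :=
  (2 / (1 + x.1 ⬝ᵥ x.1)) ^ Fintype.card ι *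
    |(c.deflated x.2 (.inl ()) (.inl ()) • 1 - (c.deflated x.2).toBlocks₂₂).det|

theorem exists_hasFDerivAt_polar (x : (ι → ℝ) × F) :
    ∃ D : (ι → ℝ) × F →L[ℝ] (ι → ℝ) × F, HasFDerivAt c.polar D x ∧ |D.det| = c.jac x := by
  obtain ⟨D, hD, hDu⟩ := exists_hasFDerivAt_conj_householder c.deflated c.coord x
  refine ⟨D, hD, ?_⟩
  set H := householder x.1 with hH
  set N := c.deflated x.2 with hN
  set r := 2 / (1 + x.1 ⬝ᵥ x.1) with hr
  have hr0 : 0 < r := div_pos two_pos (one_add_dotProduct_self_pos _)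
  let S : (ι → ℝ) →ₗ[ℝ] Matrix (Unit ⊕ ι) (Unit ⊕ ι) ℝ :=
    { toFun u := vecMulVec (Sum.elim 1 x.1) (Sum.elim 0 u) -
        vecMulVec (Sum.elim 0 u) (Sum.elim 1 x.1)
      map_add' u v := by
        ext (i | i) (j | j) <;> simp [vecMulVec_apply] <;> ring
      map_smul' a u := by
        ext (i | i) (j | j) <;> simp [vecMulVec_apply]
        ring }
  have hS (u) : (S u)ᵀ = -S u := by simp [S, transpose_vecMulVec]
  let K : (ι → ℝ) →ₗ[ℝ] Matrix (Unit ⊕ ι) (Unit ⊕ ι) ℝ :=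
    r • (LinearMap.mulRight ℝ N - LinearMap.mulLeft ℝ N) ∘ₗ S
  have hK (u) : K u = r • (S u * N - N * S u) := rfl
  have hKmem (u) : c.toMat (c.coord (K u)) = K u := by
    rw [hK, map_smul, map_smul]
    congr 1
    exact c.toMat_coord_commutator _ _ (hS u)
  let C : (ι → ℝ) × F →ₗ[ℝ] (ι → ℝ) × F :=
    c.coord ∘ₗ LinearMap.mulRight ℝ H ∘ₗ LinearMap.mulLeft ℝ H ∘ₗ c.toMat
  have hC (y) : C y = c.coord (H * c.toMat y * H) := rfl
  let P : (ι → ℝ) × F →ₗ[ℝ] (ι → ℝ) × F :=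
    c.coord ∘ₗ (c.deflated ∘ₗ LinearMap.snd ℝ _ _ + K ∘ₗ LinearMap.fst ℝ _ _)
  have hP (u) : P u = c.coord (c.deflated u.2 + K u.1) := rfl
  have hPmem (u) : c.toMat (P u) = c.deflated u.2 + K u.1 := by
    rw [hP, map_add, map_add, hKmem]
    congr 1
    exact congrArg c.toMat (c.coord_toMat _)
  have hDCP : (D : (ι → ℝ) × F →ₗ[ℝ] (ι → ℝ) × F) = C ∘ₗ P := by
    refine LinearMap.ext fun u => ?_
    rw [LinearMap.comp_apply, hC, hPmem]
    exact hDu u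
  have hCC : C ∘ₗ C = LinearMap.id := by
    refine LinearMap.ext fun u => ?_
    rw [LinearMap.comp_apply, hC, hC,
      c.toMat_coord_conj _ _ (transpose_householder _) (householder_mul_self _),
      show H * (H * c.toMat u * H) * H = (H * H) * c.toMat u * (H * H) by noncomm_ring,
      householder_mul_self, one_mul, mul_one, c.coord_toMat, LinearMap.id_apply]
  have hCdet : |C.det| = 1 := by
    have := congrArg LinearMap.det hCC
    rw [LinearMap.det_comp, LinearMap.det_id] at this
    rw [← pow_eq_one_iff_of_nonneg (abs_nonneg _) two_ne_zero, sq_abs, sq, this]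
  have hPdet : P.det = (Matrix.toLin' ((-r) • (N (.inl ()) (.inl ()) • 1 - N.toBlocks₂₂))).det := by
    refine LinearMap.det_eq_det_of_fst_eq _ _ (fun u => ?_) fun y => ?_
    · ext i
      rw [← c.toMat_inr_inl, hPmem, hK]
      have h0 : ∀ y i, c.deflated y (.inr i) (.inl ()) = 0 := fun y i => c.toMat_inr_inl (0, y) i
      simp [h0, S, Matrix.mul_apply, vecMulVec_apply, N, mulVec, dotProduct, toBlocks₂₂]
      ring
    · rw [hP, map_zero, add_zero]
      exact congrArg Prod.snd (c.coord_toMat (0, y))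
  rw [ContinuousLinearMap.det, hDCP, LinearMap.det_comp, abs_mul, hCdet, one_mul, hPdet,
    LinearMap.det_toLin', det_smul, abs_mul, abs_pow, abs_neg, abs_of_pos hr0, jac]

end MatrixChart

section Spectrum

variable {ι : Type*} [Fintype ι] [DecidableEq ι]

theorem isRoot_charpoly_iff_exists_mulVec {R : Type*} [Field R] (M : Matrix ι ι R) (r : R) :
    M.charpoly.IsRoot r ↔ ∃ v ≠ 0, M *ᵥ v = r • v := by
  rw [IsRoot, eval_charpoly, ← exists_mulVec_eq_zero_iff]
  simp only [sub_mulVec, sub_eq_zero, scalar_apply, ← smul_one_eq_diagonal, smul_mulVec,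
    one_mulVec, eq_comm]

theorem charpoly_conj_involution {H : Matrix ι ι ℝ} (hH : H * H = 1) (W : Matrix ι ι ℝ) :
    (H * W * H).charpoly = W.charpoly := by
  rw [charpoly_mul_comm, ← mul_assoc, hH, one_mul]

theorem charpoly_of_inr_inl_eq_zero {B : Matrix (Unit ⊕ ι) (Unit ⊕ ι) ℝ}
    (h : ∀ i, B (.inr i) (.inl ()) = 0) :
    B.charpoly = (X - C (B (.inl ()) (.inl ()))) * B.toBlocks₂₂.charpoly := by
  have h21 : B.toBlocks₂₁ = 0 := by
    ext i j
    exact h i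
  conv_lhs => rw [← fromBlocks_toBlocks B, h21, charpoly_fromBlocks_zero₂₁]
  congr 1
  simp [Matrix.charpoly, toBlocks₁₁]

/-- Matrices all of whose complex eigenvalues are real. -/
def realSpectrum (ι : Type*) [Fintype ι] [DecidableEq ι] : Set (ι → ι → ℝ) :=
  {M | ∀ z : ℂ, aeval z (Matrix.of M).charpoly = 0 → z.im = 0}

theorem exists_householder_deflation {W : Matrix (Unit ⊕ ι) (Unit ⊕ ι) ℝ}
    (hW : W ∈ realSpectrum (Unit ⊕ ι)) :
    ∃ t : ι → ℝ, t ⬝ᵥ t ≤ 1 ∧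
      (∀ i, (householder t * W * householder t) (.inr i) (.inl ()) = 0) ∧
      (householder t * W * householder t).toBlocks₂₂ ∈ realSpectrum ι ∧
      ∀ r, (householder t * W * householder t).toBlocks₂₂.charpoly.IsRoot r →
        r ≤ (householder t * W * householder t) (.inl ()) (.inl ()) := by
  have hroot : W.charpoly.roots.toFinset.Nonempty := by
    obtain ⟨z, hz⟩ := IsAlgClosed.exists_aeval_eq_zero ℂ W.charpoly (by
      rw [charpoly_degree_eq_dim]
      exact_mod_cast Fintype.card_ne_zero)
    have hzr : (z.re : ℂ) = z := Complex.ext rfl (hW z hz).symm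
    refine ⟨z.re, ?_⟩
    rw [Multiset.mem_toFinset, mem_roots (charpoly_monic W).ne_zero, IsRoot]
    rw [← hzr] at hz
    have : ((W.charpoly.eval z.re : ℝ) : ℂ) = 0 := by
      rw [← hz]
      exact (aeval_algebraMap_apply_eq_algebraMap_eval z.re W.charpoly).symm
    exact_mod_cast this
  obtain ⟨l, hl, hmax⟩ := Finset.exists_max_image _ id hroot
  rw [Multiset.mem_toFinset, mem_roots (charpoly_monic W).ne_zero,
    isRoot_charpoly_iff_exists_mulVec] at hl
  replace hmax : ∀ r, W.charpoly.IsRoot r → r ≤ l := fun r hr => hmax r (by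
    rwa [Multiset.mem_toFinset, mem_roots (charpoly_monic W).ne_zero])
  obtain ⟨v, hv0, hv1, hv⟩ : ∃ v : Unit ⊕ ι → ℝ, v (.inl ()) ≤ 0 ∧
      v (.inl ()) ^ 2 + (fun i => v (.inr i)) ⬝ᵥ (fun i => v (.inr i)) = 1 ∧ W *ᵥ v = l • v := by
    obtain ⟨v, hv, hWv⟩ := hl
    have hpos : 0 < v ⬝ᵥ v := by
      simpa using dotProduct_star_self_pos_iff.2 hv
    have hsum : v ⬝ᵥ v = v (.inl ()) ^ 2 + (fun i => v (.inr i)) ⬝ᵥ (fun i => v (.inr i)) := by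
      simp [dotProduct, sq]
    have key (a : ℝ) (ha : a ^ 2 * (v ⬝ᵥ v) = 1) (ha' : a * v (.inl ()) ≤ 0) :
        ∃ v : Unit ⊕ ι → ℝ, v (.inl ()) ≤ 0 ∧
          v (.inl ()) ^ 2 + (fun i => v (.inr i)) ⬝ᵥ (fun i => v (.inr i)) = 1 ∧
          W *ᵥ v = l • v := by
      refine ⟨a • v, ha', ?_, by rw [mulVec_smul, hWv, smul_comm]⟩
      rw [← ha, hsum]
      simp only [dotProduct, Pi.smul_apply, smul_eq_mul, mul_add, Finset.mul_sum, mul_pow]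
      congr 1
      exact Finset.sum_congr rfl fun i _ => by ring
    have hsq : (√(v ⬝ᵥ v))⁻¹ ^ 2 * (v ⬝ᵥ v) = 1 := by
      rw [inv_pow, Real.sq_sqrt hpos.le, inv_mul_cancel₀ hpos.ne']
    rcases le_total (v (.inl ())) 0 with h | h
    · exact key _ hsq (mul_nonpos_of_nonneg_of_nonpos (by positivity) h)
    · exact key (-(√(v ⬝ᵥ v))⁻¹) (by rwa [neg_sq])
        (mul_nonpos_of_nonpos_of_nonneg (neg_nonpos.2 (by positivity)) h)
  set v₀ := v (.inl ()) with hv₀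
  set v' : ι → ℝ := fun i => v (.inr i) with hv'
  let t : ι → ℝ := (-(1 - v₀)⁻¹) • v'
  have hpos : 0 < 1 - v₀ := by linarith
  have htt : t ⬝ᵥ t = (1 + v₀) / (1 - v₀) := by
    simp only [t, smul_dotProduct, dotProduct_smul, smul_eq_mul]
    rw [show v' ⬝ᵥ v' = (1 - v₀) * (1 + v₀) by linear_combination hv1]
    field_simp
  have htt' : 2 / (1 + t ⬝ᵥ t) = 1 - v₀ := by
    rw [htt]
    field_simp
    ring
  have hcol : ∀ i, householder t i (.inl ()) = v i := by
    rintro (i | i)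
    · rw [householder_inl_inl, htt']
      simp [v₀]
    · rw [householder_inr_inl, htt']
      simp only [t, Pi.smul_apply, smul_eq_mul, v']
      field_simp
  have hHv : ∀ i, (householder t *ᵥ v) i = (1 : Matrix (Unit ⊕ ι) (Unit ⊕ ι) ℝ) i (.inl ()) := by
    intro i
    rw [← householder_mul_self t, mul_apply]
    exact Finset.sum_congr rfl fun k _ => by rw [hcol]
  have hB : ∀ i, (householder t * W * householder t) i (.inl ()) =
      l * (1 : Matrix (Unit ⊕ ι) (Unit ⊕ ι) ℝ) i (.inl ()) := by
    intro i
    have h : (householder t * W * householder t) i (.inl ()) = ((householder t * W) *ᵥ v) i := by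
      rw [mul_apply]
      exact Finset.sum_congr rfl fun k _ => by rw [hcol]
    rw [h, ← mulVec_mulVec, hv, mulVec_smul, ← hHv, Pi.smul_apply, smul_eq_mul]
  have h0 : ∀ i, (householder t * W * householder t) (.inr i) (.inl ()) = 0 := fun i => by
    simp [hB]
  have hchar := charpoly_of_inr_inl_eq_zero h0
  rw [charpoly_conj_involution (householder_mul_self t)] at hchar
  refine ⟨t, ?_, h0, fun z hz => hW z ?_, fun r hr => ?_⟩
  · rw [htt, div_le_one hpos]
    linarith
  · change aeval z W.charpoly = 0
    rw [hchar, map_mul]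
    exact mul_eq_zero_of_right _ hz
  · rw [hB, one_apply_eq, mul_one]
    refine hmax r ?_
    rw [hchar]
    exact root_mul_left_of_isRoot _ hr

end Spectrum

namespace MatrixChart

variable {ι F : Type*} [Fintype ι] [DecidableEq ι] [NormedAddCommGroup F] [NormedSpace ℝ F]
  (c : MatrixChart ι F)

theorem deflated_inr_inl (y : F) (i : ι) : c.deflated y (.inr i) (.inl ()) = 0 :=
  c.toMat_inr_inl (0, y) i

theorem charpoly_toMat_polar (x : (ι → ℝ) × F) : (c.toMat (c.polar x)).charpoly =
    (X - C (c.deflated x.2 (.inl ()) (.inl ()))) * (c.deflated x.2).toBlocks₂₂.charpoly := by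
  rw [toMat_polar, charpoly_conj_involution (householder_mul_self _),
    charpoly_of_inr_inl_eq_zero (c.deflated_inr_inl _)]

theorem injOn_polar :
    Set.InjOn c.polar {x | x.1 ⬝ᵥ x.1 < 1 ∧ ∀ r, (c.deflated x.2).toBlocks₂₂.charpoly.IsRoot r →
      r < c.deflated x.2 (.inl ()) (.inl ())} := by
  rintro ⟨t, y⟩ ⟨ht, hy⟩ ⟨t', y'⟩ ⟨ht', hy'⟩ hxx
  dsimp only at ht hy ht' hy'
  have hchar := c.charpoly_toMat_polar (t, y)
  rw [hxx, charpoly_toMat_polar] at hchar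
  dsimp only at hchar
  have hS := congrArg c.toMat hxx
  rw [toMat_polar, toMat_polar] at hS
  dsimp only at hS
  set N := c.deflated y with hN
  set N' := c.deflated y' with hN'
  have hl : N (.inl ()) (.inl ()) = N' (.inl ()) (.inl ()) := by
    have h1 := congrArg (eval (N (.inl ()) (.inl ()))) hchar.symm
    have h2 := congrArg (eval (N' (.inl ()) (.inl ()))) hchar
    simp only [eval_mul, eval_sub, eval_X, eval_C, sub_self, zero_mul, zero_eq_mul,
      sub_eq_zero] at h1 h2
    rcases h1 with h1 | h1
    · exact h1
    rcases h2 with h2 | h2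
    · exact h2.symm
    exact absurd (hy _ h2) (hy' _ h1).not_gt
  set H := householder t with hH
  set H' := householder t' with hH'
  have hHH : H * H = 1 := householder_mul_self t
  have hHH' : H' * H' = 1 := householder_mul_self t'
  have hcomm : N * (H * H') = (H * H') * N' := by
    calc N * (H * H') = (H * H) * N * H * H' := by rw [hHH, one_mul, mul_assoc]
      _ = H * (H * N * H) * H' := by noncomm_ring
      _ = H * H' * N' * (H' * H') := by rw [hS]; noncomm_ring
      _ = _ := by rw [hHH', mul_one]
  have hq : ∀ i, (H * H') (.inr i) (.inl ()) = 0 := by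
    by_contra! hne
    -- then `N (inl ()) (inl ())` would be an eigenvalue of the lower right block
    obtain ⟨i, hi⟩ := hne
    refine (hy _ ((isRoot_charpoly_iff_exists_mulVec _ _).2
      ⟨fun i => (H * H') (.inr i) (.inl ()), fun h0 => hi (congrFun h0 i), ?_⟩)).false
    ext i
    have := congrFun (congrFun hcomm (.inr i)) (.inl ())
    rw [mul_apply, mul_apply] at this
    simp only [Fintype.sum_sum_type, Finset.univ_unique, Finset.sum_singleton, hN, hN',
      c.deflated_inr_inl, zero_mul, zero_add, mul_zero, Finset.sum_const_zero, add_zero] at this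
    simp only [mulVec, dotProduct, toBlocks₂₂, of_apply, Pi.smul_apply, smul_eq_mul, hN]
    rw [this, ← hN, hl, mul_comm]
  set a := (H * H') (.inl ()) (.inl ()) with ha
  have hcol : ∀ i, H' i (.inl ()) = a * H i (.inl ()) := by
    intro i
    have : H' = H * (H * H') := by rw [← mul_assoc, hHH, one_mul]
    rw [this, mul_apply]
    simp only [Fintype.sum_sum_type, Finset.univ_unique, Finset.sum_singleton, hq, mul_zero,
      Finset.sum_const_zero, add_zero, ha]
    rw [mul_comm]
  have hnorm : ∀ t : ι → ℝ, ∑ i, householder t i (.inl ()) ^ 2 = 1 := by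
    intro t
    have := congrFun (congrFun (householder_mul_self t) (.inl ())) (.inl ())
    rw [mul_apply, one_apply_eq] at this
    rw [← this]
    refine Finset.sum_congr rfl fun i _ => ?_
    rw [sq, ← congrFun (congrFun (transpose_householder t) i) (.inl ()), transpose_apply]
  have hneg : ∀ t : ι → ℝ, t ⬝ᵥ t < 1 → householder t (.inl ()) (.inl ()) < 0 := by
    intro t ht
    rw [householder_inl_inl, sub_neg, lt_div_iff₀ (one_add_dotProduct_self_pos t)]
    linarith
  have ha1 : a = 1 := by
    have h1 : a ^ 2 = 1 := by
      have := hnorm t'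
      simp only [← hH', hcol, mul_pow, ← Finset.mul_sum] at this
      rwa [hnorm t, mul_one] at this
    have h2 := hcol (.inl ())
    have h3 := hneg t ht
    have h4 := hneg t' ht'
    rw [← hH] at h3
    rw [← hH', h2] at h4
    rcases mul_self_eq_one_iff.1 ((sq a).symm.trans h1) with h | h
    · exact h
    · rw [h] at h4
      linarith
  simp only [ha1, one_mul] at hcol
  have hs : 2 / (1 + t' ⬝ᵥ t') = 2 / (1 + t ⬝ᵥ t) := by
    have := hcol (.inl ())
    rw [hH, hH', householder_inl_inl, householder_inl_inl] at this
    linarith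
  have htt : t = t' := by
    ext i
    have := hcol (.inr i)
    rw [hH, hH', householder_inr_inl, householder_inr_inl, hs, neg_inj] at this
    exact (mul_left_cancel₀ (div_pos two_pos (one_add_dotProduct_self_pos t)).ne' this).symm
  have hNN : N = N' := by
    have h1 : H = H' := by rw [hH, hH', htt]
    rw [← h1, hHH, mul_one, one_mul] at hcomm
    exact hcomm
  have hyy : ((0 : ι → ℝ), y) = (0, y') := by
    rw [← c.coord_toMat (0, y), ← c.coord_toMat (0, y')]
    exact congrArg c.coord hNN
  rw [htt, (Prod.mk.inj hyy).2]

end MatrixChart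

theorem measurableSet_exists_of_isClosed {X Z : Type*} [TopologicalSpace X] [TopologicalSpace Z]
    [SigmaCompactSpace Z] [MeasurableSpace X] [OpensMeasurableSpace X] {C : Set (X × Z)}
    (hC : IsClosed C) : MeasurableSet {x | ∃ z, (x, z) ∈ C} := by
  have : {x | ∃ z, (x, z) ∈ C} =
      ⋃ n, Prod.fst '' ((fun p : X × compactCovering Z n => (p.1, (p.2 : Z))) ⁻¹' C) := by
    ext x
    simp only [Set.mem_ofPred_eq, Set.mem_iUnion, Set.mem_image, Set.mem_preimage, Prod.exists,
      Subtype.exists, exists_and_right, exists_eq_right]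
    refine ⟨fun ⟨z, hz⟩ => ?_, fun ⟨_, z, _, hz⟩ => ⟨z, hz⟩⟩
    obtain ⟨n, hn⟩ := exists_mem_compactCovering z
    exact ⟨n, z, hn, hz⟩
  rw [this]
  refine .iUnion fun n => ?_
  have := isCompact_iff_compactSpace.1 (isCompact_compactCovering Z n)
  exact (isClosedMap_fst_of_compactSpace _ (hC.preimage (by fun_prop))).measurableSet

theorem measurableSet_forall_isRoot_charpoly_lt {X ι : Type*} [Fintype ι] [DecidableEq ι]
    [TopologicalSpace X] [MeasurableSpace X] [OpensMeasurableSpace X] {A : X → Matrix ι ι ℝ}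
    {l : X → ℝ} (hA : Continuous A) (hl : Continuous l) :
    MeasurableSet {x | ∀ r, (A x).charpoly.IsRoot r → r < l x} := by
  have h : IsClosed {p : X × ℝ | (scalar ι p.2 - A p.1).det = 0 ∧ l p.1 ≤ p.2} := by
    refine .inter (isClosed_eq (Continuous.matrix_det ?_) continuous_const)
      (isClosed_le (hl.comp continuous_fst) continuous_snd)
    have : Continuous fun p : X × ℝ => scalar ι p.2 := by
      simp only [scalar_apply]
      fun_prop
    fun_prop
  convert (measurableSet_exists_of_isClosed h).compl using 1
  ext x
  simp [IsRoot, eval_charpoly]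

theorem measurableSet_realSpectrum (ι : Type*) [Fintype ι] [DecidableEq ι] :
    MeasurableSet (realSpectrum ι) := by
  have h (n : ℕ) : IsClosed {p : (ι → ι → ℝ) × ℂ |
      (scalar ι p.2 - (Matrix.of p.1).map (algebraMap ℝ ℂ)).det = 0 ∧ 1 / ((n : ℝ) + 1) ≤ |p.2.im|} := by
    refine .inter (isClosed_eq (Continuous.matrix_det ?_) continuous_const)
      (isClosed_le continuous_const (Complex.continuous_im.comp continuous_snd).abs)
    have h1 : Continuous fun p : (ι → ι → ℝ) × ℂ => scalar ι p.2 := by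
      simp only [scalar_apply]
      fun_prop
    have h2 : Continuous fun p : (ι → ι → ℝ) × ℂ => (Matrix.of p.1).map (algebraMap ℝ ℂ) :=
      Continuous.matrix_map (by exact continuous_fst) Complex.continuous_ofReal
    fun_prop
  convert (MeasurableSet.iUnion fun n => measurableSet_exists_of_isClosed (h n)).compl using 1
  ext M
  simp only [realSpectrum, Set.mem_ofPred_eq, Set.mem_compl_iff, Set.mem_iUnion, not_exists, not_and,
    not_le]
  have key (z : ℂ) : aeval z (Matrix.of M).charpoly =
      (scalar ι z - (Matrix.of M).map (algebraMap ℝ ℂ)).det := by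
    rw [← eval_charpoly, charpoly_map, eval_map_algebraMap]
  constructor
  · intro hM n z hz
    rw [hM z ((key z).trans hz), abs_zero]
    positivity
  · intro hM z hz
    by_contra hne
    obtain ⟨n, hn⟩ := exists_nat_one_div_lt (abs_pos.2 hne)
    exact (hM n z ((key z).symm.trans hz)).not_gt hn

theorem volume_setOf_dotProduct_self_eq_one (ι : Type*) [Fintype ι] :
    volume {t : ι → ℝ | t ⬝ᵥ t = 1} = 0 := by
  have h := Measure.addHaar_sphere_of_ne_zero (volume : Measure (EuclideanSpace ℝ ι)) 0 one_ne_zero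
  rw [← (EuclideanSpace.volume_preserving_symm_measurableEquiv_toLp ι).symm.measure_preimage_equiv] at h
  convert h using 2
  ext t
  simp [EuclideanSpace.norm_eq, dotProduct, sq]

theorem volume_pi_Icc_zero_one (ι κ : Type*) [Fintype ι] [Fintype κ] :
    volume (Set.univ.pi fun _ : ι => Set.univ.pi fun _ : κ => Set.Icc (0 : ℝ) 1) = 1 := by
  simp only [volume_pi_pi, Real.volume_Icc, sub_zero, ENNReal.ofReal_one, Finset.prod_const_one]

section Frobenius

variable {ι κ : Type*} [Fintype ι] [Fintype κ]

/-- The unnormalized standard Gaussian density on a space of matrices. -/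
noncomputable def gaussianWeight (M : Matrix ι κ ℝ) : ENNReal :=
  ENNReal.ofReal (Real.exp (-(∑ i, ∑ j, M i j ^ 2) / 2))

theorem sum_sum_sq_eq_trace (M : Matrix ι κ ℝ) : ∑ i, ∑ j, M i j ^ 2 = (M * Mᵀ).trace := by
  simp [trace, mul_apply, sq]

theorem gaussianWeight_conj_involution [DecidableEq ι] {H : Matrix ι ι ℝ} (hH : Hᵀ = H)
    (hH' : H * H = 1) (M : Matrix ι ι ℝ) : gaussianWeight (H * M * H) = gaussianWeight M := by
  rw [gaussianWeight, gaussianWeight, sum_sum_sq_eq_trace, sum_sum_sq_eq_trace, transpose_mul,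
    transpose_mul, hH, show H * M * H * (H * (Mᵀ * H)) = H * (M * (H * H) * Mᵀ * H) by
      simp only [Matrix.mul_assoc], hH', mul_one, trace_mul_comm, Matrix.mul_assoc, hH', mul_one]

theorem measurable_gaussianWeight :
    Measurable (fun M : ι → κ → ℝ => gaussianWeight (Matrix.of M)) := by
  unfold gaussianWeight
  simp only [of_apply]
  fun_prop

end Frobenius

namespace MatrixChart

variable {ι : Type*} [Fintype ι] [DecidableEq ι]

/-- The chart of the space of all matrices. -/
def full (ι : Type*) [Fintype ι] [DecidableEq ι] : MatrixChart ι (ℝ × (ι → ℝ) × (ι → ι → ℝ)) where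
  toMat :=
    { toFun x := fromBlocks (of fun _ _ => x.2.1) (of fun _ => x.2.2.1) (of fun i _ => x.1 i)
        (of x.2.2.2)
      map_add' x y := by ext (i | i) (j | j) <;> rfl
      map_smul' a x := by ext (i | i) (j | j) <;> rfl }
  coord :=
    { toFun A := (fun i => A (.inr i) (.inl ()), A (.inl ()) (.inl ()), fun j => A (.inl ()) (.inr j),
        fun i j => A (.inr i) (.inr j))
      map_add' x y := rfl
      map_smul' a x := rfl }
  coord_toMat _ := rfl
  toMat_inr_inl _ _ := rfl
  toMat_coord_commutator _ _ _ := by ext (i | i) (j | j) <;> rfl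
  toMat_coord_conj _ _ _ _ := by ext (i | i) (j | j) <;> rfl

section Symm

variable {V : Type*} [AddCommGroup V] [Module ℝ V]

/-- The symmetric matrix with first column `(x.2.1, x.1)` and lower right block `Φ x.2.2`. -/
def symmToMat (Φ : V →ₗ[ℝ] Matrix ι ι ℝ) :
    (ι → ℝ) × ℝ × V →ₗ[ℝ] Matrix (Unit ⊕ ι) (Unit ⊕ ι) ℝ where
  toFun x := fromBlocks (of fun _ _ => x.2.1) (of fun _ => x.1) (of fun i _ => x.1 i) (Φ x.2.2)
  map_add' x y := by ext (i | i) (j | j) <;> simp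
  map_smul' a x := by ext (i | i) (j | j) <;> simp

/-- The first column of a matrix, and the image of its lower right block under `Ψ`. -/
def symmCoord (Ψ : Matrix ι ι ℝ →ₗ[ℝ] V) :
    Matrix (Unit ⊕ ι) (Unit ⊕ ι) ℝ →ₗ[ℝ] (ι → ℝ) × ℝ × V where
  toFun A := (fun i => A (.inr i) (.inl ()), A (.inl ()) (.inl ()), Ψ A.toBlocks₂₂)
  map_add' x y := Prod.ext rfl (Prod.ext rfl (map_add Ψ x.toBlocks₂₂ y.toBlocks₂₂))
  map_smul' a x := Prod.ext rfl (Prod.ext rfl (map_smul Ψ a x.toBlocks₂₂))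

variable {Φ : V →ₗ[ℝ] Matrix ι ι ℝ} {Ψ : Matrix ι ι ℝ →ₗ[ℝ] V}

omit [Fintype ι] [DecidableEq ι] in
theorem symmCoord_symmToMat (hΨ : ∀ v, Ψ (Φ v) = v) (x : (ι → ℝ) × ℝ × V) :
    symmCoord Ψ (symmToMat Φ x) = x :=
  Prod.ext rfl (Prod.ext rfl (hΨ x.2.2))

omit [Fintype ι] [DecidableEq ι] in
theorem transpose_symmToMat (hΦ : ∀ v, (Φ v)ᵀ = Φ v) (x : (ι → ℝ) × ℝ × V) :
    (symmToMat Φ x)ᵀ = symmToMat Φ x := by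
  ext (i | i) (j | j)
  · rfl
  · rfl
  · rfl
  · exact congrFun (congrFun (hΦ x.2.2) i) j

omit [Fintype ι] [DecidableEq ι] in
theorem symmToMat_symmCoord (hΦ' : ∀ M, Mᵀ = M → Φ (Ψ M) = M)
    (A : Matrix (Unit ⊕ ι) (Unit ⊕ ι) ℝ) (hA : Aᵀ = A) : symmToMat Φ (symmCoord Ψ A) = A := by
  have h (i j) : A i j = A j i := congrFun (congrFun hA j) i
  ext (i | i) (j | j)
  · rfl
  · exact h _ _
  · rfl
  · refine congrFun (congrFun (hΦ' A.toBlocks₂₂ ?_) i) j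
    ext i j
    exact h _ _

/-- The chart of the space of symmetric matrices induced by a linear parametrization `Φ`, with left
inverse `Ψ`, of the symmetric matrices of smaller size. -/
def symm (hΨ : ∀ v, Ψ (Φ v) = v) (hΦ : ∀ v, (Φ v)ᵀ = Φ v) (hΦ' : ∀ M, Mᵀ = M → Φ (Ψ M) = M) :
    MatrixChart ι (ℝ × V) where
  toMat := symmToMat Φ
  coord := symmCoord Ψ
  coord_toMat := symmCoord_symmToMat hΨ
  toMat_inr_inl _ _ := rfl
  toMat_coord_commutator x A hA := symmToMat_symmCoord hΦ' _ (by
    rw [transpose_sub, transpose_mul, transpose_mul, hA, transpose_symmToMat hΦ]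
    noncomm_ring)
  toMat_coord_conj x H hH _ := symmToMat_symmCoord hΦ' _ (by
    rw [transpose_mul, transpose_mul, hH, transpose_symmToMat hΦ, Matrix.mul_assoc])

end Symm

end MatrixChart

theorem Measurable.comp_matrix {X ι κ : Type*} [TopologicalSpace X]
    [MeasurableSpace X] [OpensMeasurableSpace X] [Countable ι] [Countable κ]
    {G : Matrix ι κ ℝ → ENNReal}
    (hG : Measurable fun M : ι → κ → ℝ => G (Matrix.of M)) {f : X → Matrix ι κ ℝ}
    (hf : Continuous f) : Measurable fun x => G (f x) := by
  have hf' : Continuous fun x i j => f x i j := hf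
  exact hG.comp hf'.measurable

/-- The total mass of the `t`-factor of the Jacobian in `MatrixChart.jac`. -/
noncomputable def householderMass (ι : Type*) [Fintype ι] : ENNReal :=
  ∫⁻ t in {t : ι → ℝ | t ⬝ᵥ t < 1}, ENNReal.ofReal ((2 / (1 + t ⬝ᵥ t)) ^ Fintype.card ι)

namespace MatrixChart

variable {ι F : Type*} [Fintype ι] [DecidableEq ι] [NormedAddCommGroup F] [NormedSpace ℝ F]
  (c : MatrixChart ι F)

/-- The parameters whose upper left entry exceeds all real eigenvalues of the lower right block. -/
def dominant : Set F := {y | ∀ r, (c.deflated y).toBlocks₂₂.charpoly.IsRoot r →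
  r < c.deflated y (.inl ()) (.inl ())}

/-- The `y`-factor of the pullback along `polar` of a Gaussian integrand. -/
noncomputable def pullback (G : Matrix (Unit ⊕ ι) (Unit ⊕ ι) ℝ → ENNReal) (y : F) : ENNReal :=
  ENNReal.ofReal |(c.deflated y (.inl ()) (.inl ()) • 1 - (c.deflated y).toBlocks₂₂).det| *
    (G (c.deflated y) * gaussianWeight (c.deflated y))

theorem ofReal_jac_mul {G : Matrix (Unit ⊕ ι) (Unit ⊕ ι) ℝ → ENNReal}
    (hG' : ∀ A B, A.charpoly = B.charpoly → G A = G B) (x : (ι → ℝ) × F) :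
    ENNReal.ofReal (c.jac x) * (G (c.toMat (c.polar x)) * gaussianWeight (c.toMat (c.polar x))) =
      ENNReal.ofReal ((2 / (1 + x.1 ⬝ᵥ x.1)) ^ Fintype.card ι) * c.pullback G x.2 := by
  rw [jac, toMat_polar, gaussianWeight_conj_involution (transpose_householder _)
    (householder_mul_self _), hG' _ _ (charpoly_conj_involution (householder_mul_self _) _),
    ENNReal.ofReal_mul (pow_nonneg (div_pos two_pos (one_add_dotProduct_self_pos _)).le _),
    mul_assoc, pullback]

variable [FiniteDimensional ℝ F]

theorem continuous_toMat : Continuous c.toMat := c.toMat.continuous_of_finiteDimensional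

theorem continuous_deflated : Continuous c.deflated := c.deflated.continuous_of_finiteDimensional

variable [MeasureSpace F] [BorelSpace F]

theorem measurableSet_dominant : MeasurableSet c.dominant :=
  measurableSet_forall_isRoot_charpoly_lt
    (c.continuous_deflated.matrix_submatrix Sum.inr Sum.inr)
    (c.continuous_deflated.matrix_elem _ _)

theorem measurable_pullback {G : Matrix (Unit ⊕ ι) (Unit ⊕ ι) ℝ → ENNReal}
    (hG : Measurable fun M : Unit ⊕ ι → Unit ⊕ ι → ℝ => G (Matrix.of M)) :
    Measurable (c.pullback G) := by
  have h1 : Continuous fun y => c.deflated y (.inl ()) (.inl ()) :=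
    c.continuous_deflated.matrix_elem _ _
  have h2 : Continuous fun y => (c.deflated y).toBlocks₂₂ :=
    c.continuous_deflated.matrix_submatrix Sum.inr Sum.inr
  have h3 : Continuous fun y =>
      |(c.deflated y (.inl ()) (.inl ()) • 1 - (c.deflated y).toBlocks₂₂).det| := by fun_prop
  exact h3.measurable.ennreal_ofReal.mul ((hG.comp_matrix c.continuous_deflated).mul
    (measurable_gaussianWeight.comp_matrix c.continuous_deflated))

theorem householderMass_mul_le [(volume : Measure F).IsAddHaarMeasure]
    {G : Matrix (Unit ⊕ ι) (Unit ⊕ ι) ℝ → ENNReal}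
    (hG : Measurable fun M : Unit ⊕ ι → Unit ⊕ ι → ℝ => G (Matrix.of M))
    (hG' : ∀ A B, A.charpoly = B.charpoly → G A = G B) :
    householderMass ι * ∫⁻ y in c.dominant, c.pullback G y ≤
      ∫⁻ x, G (c.toMat x) * gaussianWeight (c.toMat x) := by
  have : (volume : Measure ((ι → ℝ) × F)).IsAddHaarMeasure :=
    Measure.prod.instIsAddHaarMeasure volume volume
  choose D hD hDj using c.exists_hasFDerivAt_polar
  have hs : MeasurableSet ({t : ι → ℝ | t ⬝ᵥ t < 1} ×ˢ c.dominant) :=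
    (measurableSet_lt (by unfold dotProduct; fun_prop) measurable_const).prod
      c.measurableSet_dominant
  calc householderMass ι * ∫⁻ y in c.dominant, c.pullback G y
      = ∫⁻ x in {t : ι → ℝ | t ⬝ᵥ t < 1} ×ˢ c.dominant, ENNReal.ofReal |(D x).det| *
          (G (c.toMat (c.polar x)) * gaussianWeight (c.toMat (c.polar x))) := by
        simp only [hDj, c.ofReal_jac_mul hG']
        rw [Measure.volume_eq_prod, ← Measure.prod_restrict,
          lintegral_prod_mul (f := fun t : ι → ℝ =>
            ENNReal.ofReal ((2 / (1 + t ⬝ᵥ t)) ^ Fintype.card ι))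
            (by unfold dotProduct; fun_prop) (c.measurable_pullback hG).aemeasurable,
          householderMass]
    _ = ∫⁻ x in c.polar '' ({t : ι → ℝ | t ⬝ᵥ t < 1} ×ˢ c.dominant),
          G (c.toMat x) * gaussianWeight (c.toMat x) :=
        (lintegral_image_eq_lintegral_abs_det_fderiv_mul volume hs
          (fun x _ => (hD x).hasFDerivWithinAt) c.injOn_polar
          fun x => G (c.toMat x) * gaussianWeight (c.toMat x)).symm
    _ ≤ _ := setLIntegral_le_lintegral _ _

theorem setLIntegral_realSpectrum_le [(volume : Measure F).IsAddHaarMeasure]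
    {G : Matrix (Unit ⊕ ι) (Unit ⊕ ι) ℝ → ENNReal}
    (hG : Measurable fun M : Unit ⊕ ι → Unit ⊕ ι → ℝ => G (Matrix.of M))
    (hG' : ∀ A B, A.charpoly = B.charpoly → G A = G B) :
    ∫⁻ x in {x | c.toMat x ∈ realSpectrum (Unit ⊕ ι)},
        G (c.toMat x) * gaussianWeight (c.toMat x) ≤
      householderMass ι * ∫⁻ y in {y | (c.deflated y).toBlocks₂₂ ∈ realSpectrum ι} ∩ c.dominant,
        c.pullback G y := by
  have : (volume : Measure ((ι → ℝ) × F)).IsAddHaarMeasure :=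
    Measure.prod.instIsAddHaarMeasure volume volume
  choose D hD hDj using c.exists_hasFDerivAt_polar
  set R : Set F := {y | (c.deflated y).toBlocks₂₂ ∈ realSpectrum ι} with hR
  set Z : Set F :=
    {y | (c.deflated y (.inl ()) (.inl ()) • 1 - (c.deflated y).toBlocks₂₂).det = 0} with hZ
  have h1 : Continuous fun y => c.deflated y (.inl ()) (.inl ()) :=
    c.continuous_deflated.matrix_elem _ _
  have h2 : Continuous fun y => (c.deflated y).toBlocks₂₂ :=
    c.continuous_deflated.matrix_submatrix Sum.inr Sum.inr
  have hRm : MeasurableSet R := by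
    have h2' : Continuous fun y i j => (c.deflated y).toBlocks₂₂ i j := h2
    exact h2'.measurable (measurableSet_realSpectrum ι)
  have hZm : MeasurableSet Z :=
    (isClosed_eq (by fun_prop) continuous_const).measurableSet
  have hs : MeasurableSet ({t : ι → ℝ | t ⬝ᵥ t ≤ 1} ×ˢ (R ∩ c.dominant ∪ Z)) :=
    (measurableSet_le (by unfold dotProduct; fun_prop) measurable_const).prod
      ((hRm.inter c.measurableSet_dominant).union hZm)
  have hsub : {x | c.toMat x ∈ realSpectrum (Unit ⊕ ι)} ⊆
      c.polar '' ({t : ι → ℝ | t ⬝ᵥ t ≤ 1} ×ˢ (R ∩ c.dominant ∪ Z)) := by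
    intro x hx
    obtain ⟨t, ht, h0, hB, hroots⟩ := exists_householder_deflation hx
    have hB' := c.toMat_coord_conj x _ (transpose_householder t) (householder_mul_self t)
    set B := householder t * c.toMat x * householder t with hBdef
    have h0' : (c.coord B).1 = 0 := by
      ext i
      rw [← c.toMat_inr_inl, hB', h0]
      rfl
    have hdefl : c.deflated (c.coord B).2 = B := by
      conv_rhs => rw [← hB', ← Prod.mk.eta (p := c.coord B), h0']
      rfl
    refine ⟨(t, (c.coord B).2), ⟨ht, ?_⟩, ?_⟩
    · by_cases hdet : (c.coord B).2 ∈ Z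
      · exact .inr hdet
      refine .inl ⟨?_, fun r hr => ?_⟩
      · rw [hR, Set.mem_ofPred_eq, hdefl]
        exact hB
      · rw [hdefl] at hr ⊢
        refine (hroots r hr).lt_of_ne fun hne => hdet ?_
        rw [hZ, Set.mem_ofPred_eq, hdefl, ← hne, smul_one_eq_diagonal, ← scalar_apply,
          ← eval_charpoly]
        exact hr
    · rw [polar]
      dsimp only
      rw [hdefl, hBdef, show householder t * (householder t * c.toMat x * householder t) *
        householder t = (householder t * householder t) * c.toMat x *
          (householder t * householder t) by noncomm_ring, householder_mul_self, one_mul, mul_one,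
        c.coord_toMat]
  have hmass : ∫⁻ t in {t : ι → ℝ | t ⬝ᵥ t ≤ 1},
      ENNReal.ofReal ((2 / (1 + t ⬝ᵥ t)) ^ Fintype.card ι) = householderMass ι := by
    refine setLIntegral_congr ?_
    have : ∀ᵐ t : ι → ℝ, t ⬝ᵥ t ≠ 1 := measure_eq_zero_iff_ae_notMem.1
      (volume_setOf_dotProduct_self_eq_one ι)
    filter_upwards [this] with t ht
    exact propext ⟨fun h => lt_of_le_of_ne h ht, fun h => le_of_lt h⟩
  have hvanish : ∫⁻ y in R ∩ c.dominant ∪ Z, c.pullback G y ≤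
      ∫⁻ y in R ∩ c.dominant, c.pullback G y := by
    refine (lintegral_union_le _ _ _).trans ?_
    rw [setLIntegral_eq_zero hZm, add_zero]
    intro y hy
    rw [pullback, hy.out, abs_zero, ENNReal.ofReal_zero, zero_mul]
    rfl
  calc _ ≤ ∫⁻ x in {t : ι → ℝ | t ⬝ᵥ t ≤ 1} ×ˢ (R ∩ c.dominant ∪ Z),
          ENNReal.ofReal |(D x).det| *
          (G (c.toMat (c.polar x)) * gaussianWeight (c.toMat (c.polar x))) :=
        setLIntegral_le_of_subset_image volume hD hs hsub
          ((hG.comp_matrix c.continuous_toMat).mul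
            (measurable_gaussianWeight.comp_matrix c.continuous_toMat))
    _ = householderMass ι * ∫⁻ y in R ∩ c.dominant ∪ Z, c.pullback G y := by
        simp only [hDj, c.ofReal_jac_mul hG']
        rw [Measure.volume_eq_prod, ← Measure.prod_restrict,
          lintegral_prod_mul (f := fun t : ι → ℝ =>
            ENNReal.ofReal ((2 / (1 + t ⬝ᵥ t)) ^ Fintype.card ι))
            (by unfold dotProduct; fun_prop) (c.measurable_pullback hG).aemeasurable,
          hmass]
    _ ≤ _ := by gcongr

end MatrixChart

instance isAddHaarMeasure_volume_pi_pi {ι κ : Type*} [Fintype ι] [Fintype κ] :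
    (volume : Measure (ι → κ → ℝ)).IsAddHaarMeasure :=
  Measure.pi.isAddHaarMeasure fun _ => volume

theorem lintegral_exp_neg_mul_dotProduct_self (ι : Type*) [Fintype ι] {b : ℝ} (hb : 0 < b) :
    ∫⁻ w : ι → ℝ, ENNReal.ofReal (Real.exp (-b * (w ⬝ᵥ w))) =
      ENNReal.ofReal √(Real.pi / b) ^ Fintype.card ι := by
  have h (w : ι → ℝ) : Real.exp (-b * (w ⬝ᵥ w)) = ∏ i, Real.exp (-b * w i ^ 2) := by
    rw [← Real.exp_sum, dotProduct, Finset.mul_sum]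
    simp only [sq]
  simp only [h]
  rw [lintegral_ofReal_fintype_prod (fun _ x => Real.exp (-b * x ^ 2))
    (fun _ => integrable_exp_neg_mul_sq hb) (fun _ _ => (Real.exp_pos _).le)]
  rw [← ofReal_integral_eq_lintegral_ofReal (integrable_exp_neg_mul_sq hb)
    (.of_forall fun _ => (Real.exp_pos _).le), integral_gaussian, Finset.prod_const,
    Finset.card_univ]

section Spectrum

variable {ι : Type*} [Fintype ι] [DecidableEq ι]

/-- The class function on lower right blocks obtained from `G` by adding a dominant eigenvalue `l`
and weighting by the characteristic polynomial at `l`. -/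
noncomputable def adjoinRoot (G : Matrix (Unit ⊕ ι) (Unit ⊕ ι) ℝ → ENNReal) (l : ℝ) :
    Matrix ι ι ℝ → ENNReal :=
  {M | ∀ r, M.charpoly.IsRoot r → r < l}.indicator fun M =>
    ENNReal.ofReal |(l • 1 - M).det| * G (fromBlocks (of fun _ _ => l) 0 0 M)

variable {G : Matrix (Unit ⊕ ι) (Unit ⊕ ι) ℝ → ENNReal}

theorem adjoinRoot_congr (hG' : ∀ A B, A.charpoly = B.charpoly → G A = G B) (l : ℝ)
    {A B : Matrix ι ι ℝ} (h : A.charpoly = B.charpoly) : adjoinRoot G l A = adjoinRoot G l B := by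
  have h1 : G (fromBlocks (of fun _ _ => l) 0 0 A) = G (fromBlocks (of fun _ _ => l) 0 0 B) :=
    hG' _ _ (by rw [charpoly_fromBlocks_zero₂₁, charpoly_fromBlocks_zero₂₁, h])
  have h2 (M : Matrix ι ι ℝ) : (l • 1 - M).det = M.charpoly.eval l := by
    rw [eval_charpoly, scalar_apply, smul_one_eq_diagonal]
  classical
  simp only [adjoinRoot, Set.indicator_apply, Set.mem_ofPred_eq, h, h1, h2]

theorem measurable_adjoinRoot
    (hG : Measurable fun M : Unit ⊕ ι → Unit ⊕ ι → ℝ => G (Matrix.of M)) :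
    Measurable fun p : ℝ × (ι → ι → ℝ) => adjoinRoot G p.1 (Matrix.of p.2) := by
  have h1 : Continuous fun p : ℝ × (ι → ι → ℝ) => Matrix.of p.2 := continuous_snd
  have h2 : Continuous fun p : ℝ × (ι → ι → ℝ) =>
      fromBlocks (of fun _ _ : Unit => p.1) 0 0 (Matrix.of p.2) :=
    .matrix_fromBlocks (continuous_matrix fun _ _ => continuous_fst) continuous_const
      continuous_const h1
  have h3 : Continuous fun p : ℝ × (ι → ι → ℝ) => |(p.1 • 1 - Matrix.of p.2).det| := by fun_prop
  exact (h3.measurable.ennreal_ofReal.mul (hG.comp_matrix h2)).indicator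
    (measurableSet_forall_isRoot_charpoly_lt h1 continuous_fst)

omit [DecidableEq ι] in
theorem gaussianWeight_fromBlocks (l : ℝ) (u c : ι → ℝ) (M : Matrix ι ι ℝ) :
    gaussianWeight (fromBlocks (of fun _ _ : Unit => l) (of fun _ : Unit => u)
      (of fun i (_ : Unit) => c i) M) =
      ENNReal.ofReal (Real.exp (-(1 / 2) * l ^ 2)) *
        (ENNReal.ofReal (Real.exp (-(1 / 2) * (u ⬝ᵥ u + c ⬝ᵥ c))) * gaussianWeight M) := by
  rw [gaussianWeight, gaussianWeight, ← ENNReal.ofReal_mul (Real.exp_pos _).le,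
    ← ENNReal.ofReal_mul (Real.exp_pos _).le, ← Real.exp_add, ← Real.exp_add]
  congr 2
  simp [Fintype.sum_sum_type, Finset.sum_add_distrib, dotProduct, ← sq]
  ring

end Spectrum

namespace MatrixChart

theorem indicator_dominant_pullback {ι F : Type*} [Fintype ι] [DecidableEq ι]
    [NormedAddCommGroup F] [NormedSpace ℝ F] (c : MatrixChart ι F)
    {G : Matrix (Unit ⊕ ι) (Unit ⊕ ι) ℝ → ENNReal}
    (hG' : ∀ A B, A.charpoly = B.charpoly → G A = G B) (y : F) :
    c.dominant.indicator (c.pullback G) y =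
      adjoinRoot G (c.deflated y (.inl ()) (.inl ())) (c.deflated y).toBlocks₂₂ *
        gaussianWeight (c.deflated y) := by
  have h : G (c.deflated y) = G (fromBlocks (of fun _ _ => c.deflated y (.inl ()) (.inl ())) 0 0
      (c.deflated y).toBlocks₂₂) := by
    refine hG' _ _ ?_
    rw [charpoly_of_inr_inl_eq_zero (c.deflated_inr_inl y),
      charpoly_of_inr_inl_eq_zero fun _ => rfl]
    rfl
  classical
  simp only [adjoinRoot, dominant, pullback, Set.indicator_apply, Set.mem_ofPred_eq, h, ite_mul,
    zero_mul, mul_assoc]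

variable (ι : Type*) [Fintype ι] [DecidableEq ι]

theorem measurePreserving_full_toMat :
    MeasurePreserving (fun x i j => (full ι).toMat x i j) := by
  have h1 : (volume : Measure ((ι → ℝ) × (ι → ι → ℝ))).IsAddHaarMeasure :=
    Measure.prod.instIsAddHaarMeasure volume volume
  have h2 : (volume : Measure (ℝ × (ι → ℝ) × (ι → ι → ℝ))).IsAddHaarMeasure :=
    Measure.prod.instIsAddHaarMeasure volume volume
  have h3 : (volume : Measure ((ι → ℝ) × ℝ × (ι → ℝ) × (ι → ι → ℝ))).IsAddHaarMeasure :=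
    Measure.prod.instIsAddHaarMeasure volume volume
  let e : ((ι → ℝ) × ℝ × (ι → ℝ) × (ι → ι → ℝ)) ≃ₗ[ℝ] (Unit ⊕ ι → Unit ⊕ ι → ℝ) :=
    LinearEquiv.ofLinearMap (full ι).toMat (full ι).coord
      (LinearMap.ext fun A => by ext (i | i) (j | j) <;> rfl)
      (LinearMap.ext fun _ => rfl)
  refine measurePreserving_of_preimage_eq volume volume e
    (K := Set.univ.pi fun _ => Set.univ.pi fun _ => Set.Icc (0 : ℝ) 1)
    (.univ_pi fun _ => .univ_pi fun _ => measurableSet_Icc) ?_ ?_ ?_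
  · simpa only [volume_pi_Icc_zero_one] using one_ne_zero
  · simpa only [volume_pi_Icc_zero_one] using ENNReal.one_ne_top
  · have : e ⁻¹' (Set.univ.pi fun _ => Set.univ.pi fun _ => Set.Icc (0 : ℝ) 1) =
        (Set.univ.pi fun _ => Set.Icc (0 : ℝ) 1) ×ˢ Set.Icc (0 : ℝ) 1 ×ˢ
          (Set.univ.pi fun _ => Set.Icc (0 : ℝ) 1) ×ˢ
          (Set.univ.pi fun _ => Set.univ.pi fun _ => Set.Icc (0 : ℝ) 1) := by
      ext x
      simp only [Set.mem_preimage, Set.mem_univ_pi, Set.mem_prod]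
      constructor
      · exact fun h => ⟨fun i => h (.inr i) (.inl ()), h (.inl ()) (.inl ()),
          fun j => h (.inl ()) (.inr j), fun i j => h (.inr i) (.inr j)⟩
      · rintro ⟨h1, h2, h3, h4⟩ (i | i) (j | j)
        exacts [h2, h3 j, h1 i, h4 i j]
    rw [this, volume_pi_Icc_zero_one]
    simp only [Measure.volume_eq_prod, Measure.prod_prod, volume_pi_Icc_zero_one]
    simp only [volume_pi_pi, Real.volume_Icc, sub_zero, ENNReal.ofReal_one, Finset.prod_const_one,
      mul_one]

end MatrixChart

/-- There is a linear parametrization of the symmetric matrices with explicit Gaussian mass such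
that the Gaussian integral of a class function over the matrices with real spectrum is at most a
constant times its Gaussian integral over the symmetric matrices. -/
def SymmetricComparison (ι : Type) [Fintype ι] [DecidableEq ι] : Prop :=
  ∃ (V : Type) (_ : NormedAddCommGroup V) (_ : NormedSpace ℝ V) (_ : FiniteDimensional ℝ V)
    (_ : MeasureSpace V) (_ : BorelSpace V) (_ : (volume : Measure V).IsAddHaarMeasure)
    (Φ : V →ₗ[ℝ] Matrix ι ι ℝ) (Ψ : Matrix ι ι ℝ →ₗ[ℝ] V),
    (∀ v, Ψ (Φ v) = v) ∧ (∀ v, (Φ v)ᵀ = Φ v) ∧ (∀ M, Mᵀ = M → Φ (Ψ M) = M) ∧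
    ∫⁻ v, gaussianWeight (Φ v) = ENNReal.ofReal √(Real.pi / (1 / 2)) ^ Fintype.card ι *
      ENNReal.ofReal √(Real.pi / 1) ^ (Fintype.card ι).choose 2 ∧
    ∀ G : Matrix ι ι ℝ → ENNReal, Measurable (fun M : ι → ι → ℝ => G (Matrix.of M)) →
      (∀ A B, A.charpoly = B.charpoly → G A = G B) →
      ∫⁻ M in realSpectrum ι, G (Matrix.of M) * gaussianWeight (Matrix.of M) ≤
        ENNReal.ofReal √(Real.pi / (1 / 2)) ^ (Fintype.card ι).choose 2 *
          ∫⁻ v, G (Φ v) * gaussianWeight (Φ v)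

attribute [local irreducible] adjoinRoot gaussianWeight MatrixChart.dominant MatrixChart.pullback

theorem lintegral_prod_fst_mul {α β : Type*} [MeasurableSpace α] [MeasurableSpace β]
    {μ : Measure α} {ν : Measure β} [SFinite ν] {f : α → ENNReal} {g : α × β → ENNReal}
    (hf : Measurable f) (hg : Measurable g) :
    ∫⁻ z, f z.1 * g z ∂μ.prod ν = ∫⁻ x, f x * ∫⁻ y, g (x, y) ∂ν ∂μ := by
  have h : Measurable fun z : α × β => f z.1 * g z := (hf.comp measurable_fst).mul hg
  rw [lintegral_prod _ h.aemeasurable]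
  exact lintegral_congr fun x =>
    lintegral_const_mul (f := fun y => g (x, y)) (f x) (hg.comp measurable_prodMk_left)

section Integrals

open MatrixChart

variable {ι : Type*} [Fintype ι] [DecidableEq ι] {G : Matrix (Unit ⊕ ι) (Unit ⊕ ι) ℝ → ENNReal}

theorem setLIntegral_realSpectrum_sum_le
    (hG : Measurable fun M : Unit ⊕ ι → Unit ⊕ ι → ℝ => G (Matrix.of M))
    (hG' : ∀ A B, A.charpoly = B.charpoly → G A = G B) :
    ∫⁻ M in realSpectrum (Unit ⊕ ι), G (Matrix.of M) * gaussianWeight (Matrix.of M) ≤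
      householderMass ι * ∫⁻ l : ℝ, ENNReal.ofReal (Real.exp (-(1 / 2) * l ^ 2)) *
        (ENNReal.ofReal √(Real.pi / (1 / 2)) ^ Fintype.card ι *
          ∫⁻ M in realSpectrum ι,
            adjoinRoot G l (Matrix.of M) * gaussianWeight (Matrix.of M)) := by
  have h1 : (volume : Measure ((ι → ℝ) × (ι → ι → ℝ))).IsAddHaarMeasure :=
    Measure.prod.instIsAddHaarMeasure volume volume
  have h2 : (volume : Measure (ℝ × (ι → ℝ) × (ι → ι → ℝ))).IsAddHaarMeasure :=
    Measure.prod.instIsAddHaarMeasure volume volume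
  have hGw : Measurable fun M : Unit ⊕ ι → Unit ⊕ ι → ℝ =>
      G (Matrix.of M) * gaussianWeight (Matrix.of M) := hG.mul measurable_gaussianWeight
  rw [← (measurePreserving_full_toMat ι).setLIntegral_comp_preimage
    (measurableSet_realSpectrum _) hGw]
  refine ((full ι).setLIntegral_realSpectrum_le hG hG').trans ?_
  gcongr householderMass ι * ?_
  rw [Set.inter_comm, ← setLIntegral_indicator (full ι).measurableSet_dominant]
  have hy (y : ℝ × (ι → ℝ) × (ι → ι → ℝ)) :
      (full ι).dominant.indicator ((full ι).pullback G) y =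
        ENNReal.ofReal (Real.exp (-(1 / 2) * y.1 ^ 2)) *
          (ENNReal.ofReal (Real.exp (-(1 / 2) * (y.2.1 ⬝ᵥ y.2.1))) *
            (adjoinRoot G y.1 (Matrix.of y.2.2) * gaussianWeight (Matrix.of y.2.2))) := by
    have h := gaussianWeight_fromBlocks y.1 y.2.1 0 (Matrix.of y.2.2)
    rw [dotProduct_zero, add_zero] at h
    rw [indicator_dominant_pullback _ hG', show (full ι).deflated y = fromBlocks (of fun _ _ => y.1)
      (of fun _ => y.2.1) (of fun i _ => (0 : ι → ℝ) i) (of y.2.2) from rfl, h]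
    simp only [fromBlocks_apply₁₁, of_apply, toBlocks_fromBlocks₂₂]
    ring
  simp only [hy]
  have hR : {y : ℝ × (ι → ℝ) × (ι → ι → ℝ) | ((full ι).deflated y).toBlocks₂₂ ∈ realSpectrum ι} =
      Set.univ ×ˢ Set.univ ×ˢ realSpectrum ι := by
    ext y
    simp only [Set.mem_prod, Set.mem_univ, true_and]
    rfl
  have hm := measurable_adjoinRoot hG
  have hw := measurable_gaussianWeight (ι := ι) (κ := ι)
  have he : Measurable fun l : ℝ => ENNReal.ofReal (Real.exp (-(1 / 2) * l ^ 2)) := by fun_prop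
  have he' : Measurable fun w : ι → ℝ => ENNReal.ofReal (Real.exp (-(1 / 2) * (w ⬝ᵥ w))) := by
    unfold dotProduct
    fun_prop
  have ha : Measurable fun z : ℝ × (ι → ℝ) × (ι → ι → ℝ) => adjoinRoot G z.1 (Matrix.of z.2.2) :=
    hm.comp (measurable_fst.prodMk measurable_snd.snd)
  have hg : Measurable fun z : ℝ × (ι → ℝ) × (ι → ι → ℝ) =>
      ENNReal.ofReal (Real.exp (-(1 / 2) * (z.2.1 ⬝ᵥ z.2.1))) *
        (adjoinRoot G z.1 (Matrix.of z.2.2) * gaussianWeight (Matrix.of z.2.2)) :=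
    (he'.comp measurable_snd.fst).mul (ha.mul (hw.comp measurable_snd.snd))
  rw [hR, Measure.volume_eq_prod, ← Measure.prod_restrict, Measure.volume_eq_prod,
    ← Measure.prod_restrict, Measure.restrict_univ, Measure.restrict_univ,
    lintegral_prod_fst_mul he hg]
  refine (lintegral_congr fun l => ?_).le
  rw [← lintegral_exp_neg_mul_dotProduct_self ι one_half_pos]
  exact congrArg _ (lintegral_prod_mul he'.aemeasurable
    ((hm.comp measurable_prodMk_left).mul hw).aemeasurable)

variable {V : Type*} [NormedAddCommGroup V] [NormedSpace ℝ V] [FiniteDimensional ℝ V]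
  [MeasureSpace V] [BorelSpace V] [(volume : Measure V).IsAddHaarMeasure]
  {Φ : V →ₗ[ℝ] Matrix ι ι ℝ} {Ψ : Matrix ι ι ℝ →ₗ[ℝ] V}

theorem le_lintegral_symmToMat (hΨ : ∀ v, Ψ (Φ v) = v) (hΦ : ∀ v, (Φ v)ᵀ = Φ v)
    (hΦ' : ∀ M, Mᵀ = M → Φ (Ψ M) = M)
    (hG : Measurable fun M : Unit ⊕ ι → Unit ⊕ ι → ℝ => G (Matrix.of M))
    (hG' : ∀ A B, A.charpoly = B.charpoly → G A = G B) :
    householderMass ι * ∫⁻ l : ℝ, ENNReal.ofReal (Real.exp (-(1 / 2) * l ^ 2)) *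
        ∫⁻ v, adjoinRoot G l (Φ v) * gaussianWeight (Φ v) ≤
      ∫⁻ x, G (symmToMat Φ x) * gaussianWeight (symmToMat Φ x) := by
  have h1 : (volume : Measure (ℝ × V)).IsAddHaarMeasure :=
    Measure.prod.instIsAddHaarMeasure volume volume
  refine le_trans ?_ ((symm hΨ hΦ hΦ').householderMass_mul_le hG hG')
  gcongr householderMass ι * ?_
  rw [← lintegral_indicator (symm hΨ hΦ hΦ').measurableSet_dominant]
  have hy (y : ℝ × V) :
      (symm hΨ hΦ hΦ').dominant.indicator ((symm hΨ hΦ hΦ').pullback G) y =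
        ENNReal.ofReal (Real.exp (-(1 / 2) * y.1 ^ 2)) *
          (adjoinRoot G y.1 (Φ y.2) * gaussianWeight (Φ y.2)) := by
    have h := gaussianWeight_fromBlocks y.1 0 0 (Φ y.2)
    rw [dotProduct_zero, add_zero, mul_zero, Real.exp_zero, ENNReal.ofReal_one, one_mul] at h
    rw [indicator_dominant_pullback _ hG', show (symm hΨ hΦ hΦ').deflated y =
      fromBlocks (of fun _ _ => y.1) (of fun _ => 0) (of fun i _ => (0 : ι → ℝ) i) (Φ y.2) from rfl,
      h]
    simp only [fromBlocks_apply₁₁, of_apply, toBlocks_fromBlocks₂₂]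
    ring
  simp only [hy]
  have hΦc : Continuous fun v i j => Φ v i j := Φ.continuous_of_finiteDimensional
  have hm := measurable_adjoinRoot hG
  have hw : Measurable fun v => gaussianWeight (Φ v) :=
    measurable_gaussianWeight.comp hΦc.measurable
  have he : Measurable fun l : ℝ => ENNReal.ofReal (Real.exp (-(1 / 2) * l ^ 2)) := by fun_prop
  have ha : Measurable fun y : ℝ × V => adjoinRoot G y.1 (Φ y.2) :=
    hm.comp (measurable_fst.prodMk (hΦc.measurable.comp measurable_snd))
  have hg : Measurable fun y : ℝ × V => adjoinRoot G y.1 (Φ y.2) * gaussianWeight (Φ y.2) :=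
    ha.mul (hw.comp measurable_snd)
  rw [Measure.volume_eq_prod, lintegral_prod_fst_mul he hg]

omit [DecidableEq ι] in
theorem lintegral_gaussianWeight_symmToMat (Φ : V →ₗ[ℝ] Matrix ι ι ℝ) :
    ∫⁻ x, gaussianWeight (symmToMat Φ x) =
      ENNReal.ofReal √(Real.pi / 1) ^ Fintype.card ι *
        (ENNReal.ofReal √(Real.pi / (1 / 2)) * ∫⁻ v, gaussianWeight (Φ v)) := by
  have hx (x : (ι → ℝ) × ℝ × V) : gaussianWeight (symmToMat Φ x) =
      ENNReal.ofReal (Real.exp (-1 * (x.1 ⬝ᵥ x.1))) *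
        (ENNReal.ofReal (Real.exp (-(1 / 2) * x.2.1 ^ 2)) * gaussianWeight (Φ x.2.2)) := by
    rw [show symmToMat Φ x = fromBlocks (of fun _ _ => x.2.1) (of fun _ => x.1)
      (of fun i _ => x.1 i) (Φ x.2.2) from rfl, gaussianWeight_fromBlocks,
      show -(1 / 2) * (x.1 ⬝ᵥ x.1 + x.1 ⬝ᵥ x.1) = -1 * (x.1 ⬝ᵥ x.1) by ring]
    ring
  have hΦc : Continuous fun v i j => Φ v i j := Φ.continuous_of_finiteDimensional
  have hw : Measurable fun v => gaussianWeight (Φ v) :=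
    measurable_gaussianWeight.comp hΦc.measurable
  have he : Measurable fun l : ℝ => ENNReal.ofReal (Real.exp (-(1 / 2) * l ^ 2)) := by fun_prop
  simp only [hx]
  rw [Measure.volume_eq_prod, lintegral_prod_mul
    (f := fun c : ι → ℝ => ENNReal.ofReal (Real.exp (-1 * (c ⬝ᵥ c))))
    (g := fun y : ℝ × V => ENNReal.ofReal (Real.exp (-(1 / 2) * y.1 ^ 2)) * gaussianWeight (Φ y.2)),
    lintegral_exp_neg_mul_dotProduct_self _ one_pos, Measure.volume_eq_prod, lintegral_prod_mul
    he.aemeasurable hw.aemeasurable,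
    ← ofReal_integral_eq_lintegral_ofReal (integrable_exp_neg_mul_sq one_half_pos)
    (.of_forall fun _ => (Real.exp_pos _).le), integral_gaussian]
  · unfold dotProduct
    fun_prop
  · exact ((he.comp measurable_fst).mul (hw.comp measurable_snd)).aemeasurable

end Integrals

namespace SymmetricComparison

variable {ι κ : Type} [Fintype ι] [DecidableEq ι] [Fintype κ] [DecidableEq κ]

open MatrixChart

theorem unit_sum (h : SymmetricComparison ι) : SymmetricComparison (Unit ⊕ ι) := by
  obtain ⟨V, _, _, _, _, _, _, Φ, Ψ, hΨ, hΦ, hΦ', hmass, hcomp⟩ := h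
  have h1 : (volume : Measure (ℝ × V)).IsAddHaarMeasure :=
    Measure.prod.instIsAddHaarMeasure volume volume
  have h2 : (volume : Measure ((ι → ℝ) × ℝ × V)).IsAddHaarMeasure :=
    Measure.prod.instIsAddHaarMeasure volume volume
  have hcard : Fintype.card (Unit ⊕ ι) = Fintype.card ι + 1 := by
    rw [Fintype.card_sum, Fintype.card_unit, add_comm]
  have hchoose : (Fintype.card ι + 1).choose 2 = Fintype.card ι + (Fintype.card ι).choose 2 := by
    rw [Nat.choose_succ_succ, Nat.choose_one_right]
  refine ⟨(ι → ℝ) × ℝ × V, inferInstance, inferInstance, inferInstance, inferInstance,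
    inferInstance, h2, symmToMat Φ, symmCoord Ψ, symmCoord_symmToMat hΨ, transpose_symmToMat hΦ,
    symmToMat_symmCoord hΦ', ?_, fun G hG hG' => ?_⟩
  · rw [lintegral_gaussianWeight_symmToMat, hmass, hcard, hchoose]
    ring
  · have hl (l : ℝ) := hcomp (adjoinRoot G l)
      ((measurable_adjoinRoot hG).comp (measurable_prodMk_left (x := l)))
      fun A B => adjoinRoot_congr hG' l
    have hle := le_lintegral_symmToMat hΨ hΦ hΦ' hG hG'
    refine (setLIntegral_realSpectrum_sum_le hG hG').trans ?_
    calc _ ≤ householderMass ι * ∫⁻ l : ℝ, ENNReal.ofReal (Real.exp (-(1 / 2) * l ^ 2)) *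
            (ENNReal.ofReal √(Real.pi / (1 / 2)) ^ Fintype.card ι *
              (ENNReal.ofReal √(Real.pi / (1 / 2)) ^ (Fintype.card ι).choose 2 *
                ∫⁻ v, adjoinRoot G l (Φ v) * gaussianWeight (Φ v))) := by
          gcongr householderMass ι * ?_
          refine lintegral_mono fun l => ?_
          dsimp only
          gcongr _ * (_ * ?_)
          exact hl l
      _ = ENNReal.ofReal √(Real.pi / (1 / 2)) ^ (Fintype.card (Unit ⊕ ι)).choose 2 *
            (householderMass ι * ∫⁻ l : ℝ, ENNReal.ofReal (Real.exp (-(1 / 2) * l ^ 2)) *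
              ∫⁻ v, adjoinRoot G l (Φ v) * gaussianWeight (Φ v)) := by
          rw [hcard, hchoose, mul_left_comm (_ ^ _), ← lintegral_const_mul' _ _
            (ENNReal.pow_ne_top ENNReal.ofReal_ne_top)]
          refine congrArg _ (lintegral_congr fun l => ?_)
          rw [pow_add]
          ring
      _ ≤ _ := by
          gcongr

theorem of_isEmpty [IsEmpty ι] : SymmetricComparison ι := by
  refine ⟨ι → ι → ℝ, inferInstance, inferInstance, inferInstance, inferInstance, inferInstance,
    inferInstance, LinearMap.id (M := Matrix ι ι ℝ), LinearMap.id (M := Matrix ι ι ℝ), fun _ => rfl,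
    fun _ => Subsingleton.elim _ _, fun _ _ => rfl, ?_, fun G hG hG' => ?_⟩
  · simp [gaussianWeight, volume_pi]
  · rw [Fintype.card_eq_zero, Nat.choose_zero_succ, pow_zero, one_mul]
    exact setLIntegral_le_lintegral _ _

theorem congr (e : ι ≃ κ) (h : SymmetricComparison ι) : SymmetricComparison κ := by
  obtain ⟨V, i1, i2, i3, i4, i5, i6, Φ, Ψ, hΨ, hΦ, hΦ', hmass, hcomp⟩ := h
  let E := reindexLinearEquiv ℝ ℝ e e
  have hw (M : Matrix ι ι ℝ) : gaussianWeight (E M) = gaussianWeight M := by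
    unfold gaussianWeight
    congr 4
    exact Fintype.sum_equiv e.symm _ _ fun i => Fintype.sum_equiv e.symm _ _ fun j => rfl
  have hc (M : Matrix ι ι ℝ) : (E M).charpoly = M.charpoly := charpoly_reindex e M
  have hE : MeasurePreserving fun (M : ι → ι → ℝ) i j => E (Matrix.of M) i j := by
    let E' : (ι → ι → ℝ) ≃ₗ[ℝ] (κ → κ → ℝ) := E
    refine measurePreserving_of_preimage_eq volume volume E'
      (K := Set.univ.pi fun _ => Set.univ.pi fun _ => Set.Icc (0 : ℝ) 1)
      (.univ_pi fun _ => .univ_pi fun _ => measurableSet_Icc) ?_ ?_ ?_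
    · simpa only [volume_pi_Icc_zero_one] using one_ne_zero
    · simpa only [volume_pi_Icc_zero_one] using ENNReal.one_ne_top
    · have : E' ⁻¹' (Set.univ.pi fun _ => Set.univ.pi fun _ => Set.Icc (0 : ℝ) 1) =
          Set.univ.pi fun _ => Set.univ.pi fun _ => Set.Icc (0 : ℝ) 1 := by
        ext M
        simp only [Set.mem_preimage, Set.mem_univ_pi]
        exact e.symm.forall_congr fun i => e.symm.forall_congr fun j => Iff.rfl
      rw [this, volume_pi_Icc_zero_one, volume_pi_Icc_zero_one]
  refine ⟨V, i1, i2, i3, i4, i5, i6, E ∘ₗ Φ, Ψ ∘ₗ E.symm, fun v => ?_, fun v => ?_, fun M hM => ?_,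
    ?_, fun G hG hG' => ?_⟩
  · simp [hΨ]
  · ext i j
    exact congrFun (congrFun (hΦ v) (e.symm i)) (e.symm j)
  · rw [LinearMap.comp_apply, LinearMap.comp_apply]
    have : Φ (Ψ (E.symm M)) = E.symm M := hΦ' _ (by
      ext i j
      exact congrFun (congrFun hM (e i)) (e j))
    exact (congrArg E this).trans (E.apply_symm_apply M)
  · rw [← Fintype.card_congr e, ← hmass]
    exact lintegral_congr fun v => hw _
  · have hGw : Measurable fun M : κ → κ → ℝ => G (Matrix.of M) * gaussianWeight (Matrix.of M) :=
      hG.mul measurable_gaussianWeight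
    rw [← hE.setLIntegral_comp_preimage (measurableSet_realSpectrum κ) hGw, ← Fintype.card_congr e]
    have hpre : (fun (M : ι → ι → ℝ) i j => E (Matrix.of M) i j) ⁻¹' realSpectrum κ =
        realSpectrum ι := by
      ext M
      exact forall_congr' fun z => by rw [← hc (Matrix.of M)]; rfl
    rw [hpre]
    convert hcomp (fun M => G (E M)) (hG.comp hE.measurable) (fun A B hAB => hG' _ _ (by
      rw [hc, hc, hAB])) using 1
    · refine lintegral_congr fun M => ?_
      rw [← hw]
      rfl
    · refine congrArg _ (lintegral_congr fun v => ?_)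
      rw [← hw]
      rfl

theorem fin (n : ℕ) : SymmetricComparison (Fin n) := by
  induction n with
  | zero => exact of_isEmpty
  | succ n ih => exact ih.unit_sum.congr (Fintype.equivOfCardEq (by simp [add_comm]))

end SymmetricComparison

theorem pi_withDensity_ofReal {ι : Type*} [Fintype ι] {E : ι → Type*} [∀ i, MeasureSpace (E i)]
    [∀ i, SigmaFinite (volume : Measure (E i))] (f : ∀ i, E i → ℝ) (hf : ∀ i, Integrable (f i))
    (hf0 : ∀ i x, 0 ≤ f i x) :
    Measure.pi (fun i => volume.withDensity fun x => ENNReal.ofReal (f i x)) =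
      volume.withDensity fun x => ENNReal.ofReal (∏ i, f i (x i)) := by
  have (i : ι) : IsFiniteMeasure (volume.withDensity fun x => ENNReal.ofReal (f i x)) :=
    isFiniteMeasure_withDensity_ofReal (hf i).2
  refine Measure.pi_eq fun s hs => ?_
  rw [withDensity_apply _ (.univ_pi hs), ← lintegral_indicator (.univ_pi hs)]
  have h (x : ∀ i, E i) :
      (Set.univ.pi s).indicator (fun x => ENNReal.ofReal (∏ i, f i (x i))) x =
        ENNReal.ofReal (∏ i, (s i).indicator (f i) (x i)) := by
    by_cases hx : x ∈ Set.univ.pi s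
    · rw [Set.indicator_of_mem hx]
      congr 1
      exact Finset.prod_congr rfl fun i _ => (Set.indicator_of_mem (hx i trivial) _).symm
    · rw [Set.indicator_of_notMem hx]
      rw [Set.mem_univ_pi, not_forall] at hx
      obtain ⟨i, hi⟩ := hx
      rw [Finset.prod_eq_zero (Finset.mem_univ i) (Set.indicator_of_notMem hi _),
        ENNReal.ofReal_zero]
  simp only [h]
  rw [lintegral_ofReal_fintype_prod _ (fun i => (hf i).indicator (hs i))
    fun i => Set.indicator_nonneg fun x _ => hf0 i x]
  refine Finset.prod_congr rfl fun i _ => ?_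
  rw [withDensity_apply _ (hs i), ← lintegral_indicator (hs i)]
  refine lintegral_congr fun x => ?_
  by_cases hx : x ∈ s i <;> simp [hx]

theorem pi_pi_gaussianReal (ι κ : Type*) [Fintype ι] [Fintype κ] :
    Measure.pi (fun _ : ι => Measure.pi fun _ : κ => gaussianReal 0 1) =
      volume.withDensity fun M => ENNReal.ofReal (√(2 * Real.pi))⁻¹ ^
        (Fintype.card ι * Fintype.card κ) * gaussianWeight (Matrix.of M) := by
  have h0 (x : ℝ) : 0 ≤ gaussianPDFReal 0 1 x := gaussianPDFReal_nonneg 0 1 x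
  have hi : Integrable fun x : κ → ℝ => ∏ j, gaussianPDFReal 0 1 (x j) :=
    .fintype_prod fun _ => integrable_gaussianPDFReal 0 1
  have hg : gaussianReal 0 1 = volume.withDensity fun x => ENNReal.ofReal (gaussianPDFReal 0 1 x) :=
    gaussianReal_of_var_ne_zero 0 one_ne_zero
  rw [hg, pi_withDensity_ofReal (fun _ : κ => gaussianPDFReal 0 1)
    (fun _ => integrable_gaussianPDFReal 0 1) (fun _ => h0),
    pi_withDensity_ofReal (fun (_ : ι) (x : κ → ℝ) => ∏ j, gaussianPDFReal 0 1 (x j))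
    (fun _ => hi) (fun _ x => Finset.prod_nonneg fun j _ => h0 _)]
  congr 1
  ext M
  rw [gaussianWeight, ← ENNReal.ofReal_pow (by positivity), ← ENNReal.ofReal_mul (by positivity)]
  congr 1
  simp only [gaussianPDFReal, NNReal.coe_one, mul_one, sub_zero, Finset.prod_mul_distrib,
    Finset.prod_const, Finset.card_univ, ← pow_mul, ← Real.exp_sum, mul_comm (Fintype.card κ)]
  simp [← Finset.sum_div, Finset.sum_neg_distrib]

theorem inv_sqrt_two_pi_pow_mul (d : ℕ) :
    (√(2 * Real.pi))⁻¹ ^ (d * d) * (√(Real.pi / (1 / 2)) ^ d.choose 2 *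
      (√(Real.pi / (1 / 2)) ^ d * √(Real.pi / 1) ^ d.choose 2)) =
      1 / 2 ^ (((d * (d - 1) : ℕ) : ℝ) / 4) := by
  have hd : d * (d - 1) = 2 * d.choose 2 := by
    rw [Nat.choose_two_right, Nat.mul_div_cancel' (Nat.even_mul_pred_self d).two_dvd]
  have hd' : d * d = d + d.choose 2 + d.choose 2 := by
    cases d with
    | zero => rfl
    | succ n =>
      rw [Nat.add_sub_cancel] at hd
      lia
  have h2 : (2 : ℝ) ^ (((d * (d - 1) : ℕ) : ℝ) / 4) = √2 ^ d.choose 2 := by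
    rw [hd, Real.sqrt_eq_rpow, ← Real.rpow_natCast, ← Real.rpow_mul zero_le_two]
    congr 1
    push_cast
    ring
  rw [h2, hd', show Real.pi / (1 / 2) = 2 * Real.pi by ring, div_one, Real.sqrt_mul zero_le_two]
  have hpi : √Real.pi ≠ 0 := (Real.sqrt_pos.2 Real.pi_pos).ne'
  have htwo : √(2 : ℝ) ≠ 0 := (Real.sqrt_pos.2 two_pos).ne'
  rw [inv_pow, pow_add, pow_add]
  simp only [mul_pow]
  field_simp

theorem pi_pi_gaussianReal_realSpectrum_le (d : ℕ) :
    Measure.pi (fun _ : Fin d => Measure.pi fun _ : Fin d => gaussianReal 0 1)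
      (realSpectrum (Fin d)) ≤ ENNReal.ofReal (1 / (2 : ℝ) ^ (((d * (d - 1) : ℕ) : ℝ) / 4)) := by
  obtain ⟨V, _, _, _, _, _, _, Φ, Ψ, -, -, -, hmass, hcomp⟩ := SymmetricComparison.fin d
  have h := hcomp 1 measurable_const fun _ _ _ => rfl
  simp only [Pi.one_apply, one_mul] at h
  rw [hmass, Fintype.card_fin] at h
  rw [pi_pi_gaussianReal, withDensity_apply _ (measurableSet_realSpectrum _),
    lintegral_const_mul' _ _ (ENNReal.pow_ne_top ENNReal.ofReal_ne_top), Fintype.card_fin,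
    ← inv_sqrt_two_pi_pow_mul]
  refine (mul_le_mul_right h _).trans_eq ?_
  repeat rw [ENNReal.ofReal_mul (by positivity)]
  repeat rw [ENNReal.ofReal_pow (by positivity)]

/-- If the entries of a random real `d × d` matrix (`d ≥ 2`) are independent standard normal
random variables, then the probability that all `d` complex eigenvalues of the matrix are
real and pairwise distinct (i.e. the matrix provides only Type R-1 recurrence features) is
at most `1 / 2^{d(d−1)/4}`. -/
theorem stmt6 (d : ℕ) (hd : 2 ≤ d) {Ω : Type*} [MeasurableSpace Ω]
    (μ : Measure Ω) [IsProbabilityMeasure μ]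
    (W : Ω → Fin d → Fin d → ℝ) (hW : Measurable W)
    (hlaw : μ.map W =
      Measure.pi (fun _ : Fin d => Measure.pi (fun _ : Fin d => gaussianReal 0 1))) :
    μ {ω | (∀ z : ℂ, (Polynomial.aeval z) (Matrix.of (W ω)).charpoly = 0 → z.im = 0) ∧
           (∀ z : ℂ,
             ((Matrix.of (W ω)).charpoly.map (algebraMap ℝ ℂ)).rootMultiplicity z ≤ 1)}
      ≤ ENNReal.ofReal (1 / (2 : ℝ) ^ (((d * (d - 1) : ℕ) : ℝ) / 4)) := by
  refine le_trans ?_ (pi_pi_gaussianReal_realSpectrum_le d)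
  rw [← hlaw, Measure.map_apply hW (measurableSet_realSpectrum _)]
  exact measure_mono fun ω hω => hω.1
end
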